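/- In the Artin–Schreier–Witt tower setting of length n+1 (with n ≥ 1), let z = u_n + y_n − y_n^p ∈ L_n, let m_n = max_{0≤i≤n−1} p^{n−1−i} ν_i, and let μ_n = deg𝔇_{L_n/K} − p^n + 1. Then there exists h ∈ L_n such that v_{L_n}( z − (h^p − h) ) = −( p^{n+1}·m_n − μ_n ). -/

import Mathlib

set_option synthInstance.maxHeartbeats 1000000
set_option maxHeartbeats 1600000

/-- The Frobenius on truncated Witt vectors over a ring of characteristic `p`: it raises
each component to the `p`-th power. -/
noncomputable def twFrobenius (p m : ℕ) {R : Type*} [CommRing R]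
    (x : TruncatedWittVector p m R) : TruncatedWittVector p m R :=
  TruncatedWittVector.mk p fun i => x.coeff i ^ p

/-- Componentwise application of a ring homomorphism to a truncated Witt vector. -/
noncomputable def twMap (p m : ℕ) {R S : Type*} [CommRing R] [CommRing S]
    (f : R →+* S) (x : TruncatedWittVector p m R) : TruncatedWittVector p m S :=
  TruncatedWittVector.mk p fun i => f (x.coeff i)

/-- A (rank-one) additive valuation on a field, written additively with value `⊤` at `0`. -/
def IsAddValuation {L : Type*} [Field L] (v : L → WithTop ℤ) : Prop :=
  (∀ x, v x = ⊤ ↔ x = 0) ∧ (∀ x y, v (x * y) = v x + v y) ∧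
    (∀ x y, min (v x) (v y) ≤ v (x + y))

section WittVectors

open WittVector

theorem init_coeff {p : ℕ} {R : Type*} [CommRing R] (x : WittVector p R) (j i : ℕ) :
    (init j x).coeff i = if i < j then x.coeff i else 0 := by
  simp [init, WittVector.select]

variable {p : ℕ} [hp : Fact p.Prime]

/-- The map `x ↦ ∑ i ≤ n, xᵢ ^ (p ^ (n - i) - 1) • D xᵢ` attached to a derivation `D`, i.e.
`p ^ (-n)` times the derivative of the `n`-th ghost component. -/
noncomputable def wittDlog {R M : Type*} [CommRing R] [AddCommGroup M] [Module R M]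
    (D : R → M) (n : ℕ) (x : WittVector p R) : M :=
  ∑ i ∈ Finset.range (n + 1), x.coeff i ^ (p ^ (n - i) - 1) • D (x.coeff i)

theorem derivation_ghostComponent {A R M : Type*} [CommRing A] [CommRing R] [Algebra A R]
    [AddCommGroup M] [Module R M] [Module A M] (D : Derivation A R M) (n : ℕ) (x : WittVector p R) :
    D (ghostComponent n x) = (p ^ n : ℕ) • wittDlog D n x := by
  rw [ghostComponent_apply, wittPolynomial_eq_sum_C_mul_X_pow, wittDlog, Finset.smul_sum]
  simp only [map_sum]
  refine Finset.sum_congr rfl fun i hi => ?_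
  have hi' : i ≤ n := by simpa [Nat.lt_succ_iff] using hi
  have h1 : (MvPolynomial.aeval x.coeff)
      (MvPolynomial.C ((p : ℤ) ^ i) * MvPolynomial.X i ^ p ^ (n - i) : MvPolynomial ℕ ℤ) =
      (p ^ i : ℕ) • (x.coeff i ^ p ^ (n - i)) := by
    simp
  rw [h1, map_nsmul, Derivation.leibniz_pow, smul_smul, ← pow_add, Nat.add_sub_cancel' hi']

/-- The universal derivation of a polynomial ring over `ℤ`, in coordinates. -/
noncomputable def mvPolynomialD (σ : Type*) :
    Derivation ℤ (MvPolynomial σ ℤ) (σ →₀ MvPolynomial σ ℤ) :=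
  MvPolynomial.mkDerivation ℤ fun i => Finsupp.single i (1 : MvPolynomial σ ℤ)

theorem wittDlog_add_mvPolynomial {σ : Type*} (n : ℕ)
    (x y : WittVector p (MvPolynomial σ ℤ)) :
    wittDlog (mvPolynomialD σ) n (x + y) =
      wittDlog (mvPolynomialD σ) n x +
      wittDlog (mvPolynomialD σ) n y := by
  set D := mvPolynomialD σ
  have h : (p ^ n : ℕ) • wittDlog D n (x + y) =
      (p ^ n : ℕ) • (wittDlog D n x + wittDlog D n y) := by
    rw [smul_add, ← derivation_ghostComponent D, ← derivation_ghostComponent D,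
      ← derivation_ghostComponent D, map_add, map_add]
  ext1 i
  have h2 := DFunLike.congr_fun h i
  simp only [Finsupp.smul_apply, nsmul_eq_mul] at h2
  refine mul_left_cancel₀ ?_ h2
  exact_mod_cast pow_ne_zero n hp.out.ne_zero

theorem derivation_aeval {σ R : Type*} [CommRing R] (D : Derivation ℤ R R) (a : σ → R)
    (P : MvPolynomial σ ℤ) :
    D (MvPolynomial.aeval a P) =
      (mvPolynomialD σ P).sum
        fun i c => MvPolynomial.aeval a c * D (a i) := by
  let _ : Algebra (MvPolynomial σ ℤ) R := (MvPolynomial.aeval a).toRingHom.toAlgebra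
  have hal : ∀ Q, algebraMap (MvPolynomial σ ℤ) R Q = MvPolynomial.aeval a Q := fun _ => rfl
  have : D.compAlgebraMap (MvPolynomial σ ℤ) =
      (Finsupp.linearCombination (MvPolynomial σ ℤ) fun i => D (a i)).compDer
        (mvPolynomialD σ) := by
    ext i
    simp [hal, mvPolynomialD]
  have h := DFunLike.congr_fun this P
  simpa [hal, Finsupp.linearCombination_apply, Algebra.smul_def] using h

theorem map_wittDlog {σ R : Type*} [CommRing R] (D : Derivation ℤ R R) (a : σ → R) (n : ℕ)
    (x : WittVector p (MvPolynomial σ ℤ)) :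
    wittDlog D n (WittVector.map (MvPolynomial.aeval a : _ →ₐ[ℤ] R).toRingHom x) =
      (wittDlog (mvPolynomialD σ) n x).sum
        fun i c => MvPolynomial.aeval a c * D (a i) := by
  let _ : Algebra (MvPolynomial σ ℤ) R := (MvPolynomial.aeval a).toRingHom.toAlgebra
  have hal : ∀ Q, algebraMap (MvPolynomial σ ℤ) R Q = MvPolynomial.aeval a Q := fun _ => rfl
  have key : ∀ f : σ →₀ MvPolynomial σ ℤ,
      (f.sum fun i c => MvPolynomial.aeval a c * D (a i)) =
        Finsupp.linearCombination (MvPolynomial σ ℤ) (fun i => D (a i)) f := by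
    intro f
    simp [Finsupp.linearCombination_apply, Algebra.smul_def, hal]
  rw [key]
  unfold wittDlog
  rw [map_sum]
  refine Finset.sum_congr rfl fun i _ => ?_
  rw [map_smul, ← key, ← derivation_aeval D, Algebra.smul_def (x.coeff i ^ _), hal, map_pow]
  rfl

theorem wittDlog_add {R : Type*} [CommRing R] (D : Derivation ℤ R R) (n : ℕ)
    (x y : WittVector p R) : wittDlog D n (x + y) = wittDlog D n x + wittDlog D n y := by
  let a : Fin 2 × ℕ → R := fun i => (![x.coeff, y.coeff] i.1) i.2
  let X : Fin 2 → WittVector p (MvPolynomial (Fin 2 × ℕ) ℤ) :=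
    fun b => WittVector.mk p fun i => MvPolynomial.X (b, i)
  let f : MvPolynomial (Fin 2 × ℕ) ℤ →+* R := (MvPolynomial.aeval a).toRingHom
  have hx : WittVector.map f (X 0) = x := by
    ext i
    simp [f, X, a, WittVector.map_coeff]
  have hy : WittVector.map f (X 1) = y := by
    ext i
    simp [f, X, a, WittVector.map_coeff]
  have h := wittDlog_add_mvPolynomial (p := p) n (X 0) (X 1)
  rw [← hx, ← hy, ← map_add, map_wittDlog, map_wittDlog, map_wittDlog, h]
  rw [Finsupp.sum_add_index']
  · simp
  · intros; simp [add_mul]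

theorem wittDlog_frobenius {R : Type*} [CommRing R] [CharP R p] (D : Derivation ℤ R R) (n : ℕ)
    (x : WittVector p R) : wittDlog D n (frobenius x) = 0 := by
  rw [wittDlog]
  refine Finset.sum_eq_zero fun i _ => ?_
  rw [coeff_frobenius_charP, Derivation.leibniz_pow]
  simp

theorem coeff_sub_mem {R : Type*} [CommRing R] (S : Subring R) {x y : WittVector p R}
    (hx : ∀ i, x.coeff i ∈ S) (hy : ∀ i, y.coeff i ∈ S) (i : ℕ) : (x - y).coeff i ∈ S := by
  let x' : WittVector p S := WittVector.mk p fun i => ⟨x.coeff i, hx i⟩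
  let y' : WittVector p S := WittVector.mk p fun i => ⟨y.coeff i, hy i⟩
  have h1 : WittVector.map S.subtype x' = x := by ext i; simp [x', WittVector.map_coeff]
  have h2 : WittVector.map S.subtype y' = y := by ext i; simp [y', WittVector.map_coeff]
  rw [← h1, ← h2, ← map_sub, WittVector.map_coeff]
  exact ((x' - y').coeff i).2

theorem eq_teichmuller_add_verschiebung {R : Type*} [CommRing R] (x : WittVector p R) :
    x = teichmuller p (x.coeff 0) + verschiebung (WittVector.mk p fun i => x.coeff (i + 1)) := by
  ext i
  rw [coeff_add_of_disjoint]
  · cases i with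
    | zero => simp
    | succ i => simp [teichmuller_coeff_pos]
  · rintro (_ | i)
    · right; simp
    · left; simp [teichmuller_coeff_pos]

theorem teichmuller_mul_coeff {R : Type*} [CommRing R] [CharP R p] (c : R) (x : WittVector p R)
    (i : ℕ) : (teichmuller p c * x).coeff i = c ^ p ^ i * x.coeff i := by
  induction i generalizing c x with
  | zero => simp [WittVector.mul_coeff_zero]
  | succ i ih =>
    have hF : frobenius (teichmuller p c) = teichmuller p (c ^ p) := by
      ext j
      rw [coeff_frobenius_charP]
      cases j with
      | zero => simp [-map_pow]
      | succ j => simp [-map_pow, teichmuller_coeff_pos, hp.out.ne_zero]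
    have h : teichmuller p c * x = teichmuller p (c * x.coeff 0) +
        verschiebung (teichmuller p (c ^ p) * WittVector.mk p fun i => x.coeff (i + 1)) := by
      conv_lhs => rw [eq_teichmuller_add_verschiebung x]
      rw [mul_add, ← map_mul, mul_comm _ (verschiebung _), ← verschiebung_mul_frobenius, hF,
        mul_comm (WittVector.mk p _)]
    rw [h, coeff_add_of_disjoint]
    · rw [teichmuller_coeff_pos _ _ _ (Nat.succ_pos i), verschiebung_coeff_succ, ih]
      simp [pow_succ', pow_mul]
    · rintro (_ | j)
      · right; simp
      · left; rw [teichmuller_coeff_pos _ _ _ (Nat.succ_pos j)]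

theorem add_coeff_of_coeff_lt_eq_zero {R : Type*} [CommRing R] (j : ℕ)
    (x y : WittVector p R) (hy : ∀ i < j, y.coeff i = 0) :
    (x + y).coeff j = x.coeff j + y.coeff j := by
  induction j generalizing x y with
  | zero => simp [add_coeff_zero]
  | succ j ih =>
    have hx' := eq_teichmuller_add_verschiebung x
    have hy' := eq_teichmuller_add_verschiebung y
    have h0 : y.coeff 0 = 0 := hy 0 (Nat.succ_pos j)
    rw [h0, teichmuller_zero, zero_add] at hy'
    have h : x + y = teichmuller p (x.coeff 0) + verschiebung
        ((WittVector.mk p fun i => x.coeff (i + 1)) +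
          WittVector.mk p fun i => y.coeff (i + 1)) := by
      conv_lhs => rw [hx', hy']
      rw [map_add, add_assoc]
    rw [h, coeff_add_of_disjoint, teichmuller_coeff_pos _ _ _ (Nat.succ_pos j),
      verschiebung_coeff_succ, zero_add, ih]
    · rfl
    · intro i hi
      exact hy (i + 1) (Nat.succ_lt_succ hi)
    · rintro (_ | j)
      · right; rw [verschiebung_coeff_zero]
      · left; simp [teichmuller_coeff_pos]

theorem sub_coeff_eq_zero {R : Type*} [CommRing R] (j : ℕ)
    (x y : WittVector p R) (hx : ∀ i < j, x.coeff i = 0) (hy : ∀ i < j, y.coeff i = 0) :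
    ∀ i < j, (x - y).coeff i = 0 := by
  intro i
  induction i using Nat.strong_induction_on with
  | _ i ih =>
    intro hij
    have h := add_coeff_of_coeff_lt_eq_zero i y (x - y) fun l hl => ih l hl (hl.trans hij)
    rw [add_sub_cancel, hx i hij, hy i hij, zero_add] at h
    exact h.symm

theorem frobenius_sub_coeff {R : Type*} [CommRing R] [CharP R p] (x : WittVector p R) (j : ℕ) :
    (frobenius x - x).coeff j =
      (frobenius (init j x) - init j x).coeff j + (x.coeff j ^ p - x.coeff j) := by
  have hp0 := hp.out.ne_zero
  have ht : ∀ i < j, (tail j x).coeff i = 0 := fun i hi => by simp [tail, WittVector.select, hi]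
  have htF : ∀ i < j, (frobenius (tail j x)).coeff i = 0 := fun i hi => by
    rw [coeff_frobenius_charP, ht i hi, zero_pow hp0]
  have hd := sub_coeff_eq_zero j _ _ htF ht
  have h1 : frobenius x - x =
      (frobenius (init j x) - init j x) + (frobenius (tail j x) - tail j x) := by
    conv_lhs => rw [← init_add_tail x j, map_add]
    ring
  have h2 := add_coeff_of_coeff_lt_eq_zero j (tail j x) (frobenius (tail j x) - tail j x) hd
  rw [add_sub_cancel, coeff_frobenius_charP] at h2
  have ht' : (tail j x).coeff j = x.coeff j := by simp [tail, WittVector.select]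
  rw [h1, add_coeff_of_coeff_lt_eq_zero j _ _ hd, ← ht', h2]
  ring

theorem frobenius_sub_coeff_of_init {R : Type*} [CommRing R] [CharP R p] (x : WittVector p R)
    {i j : ℕ} (hij : i < j) :
    (frobenius (init j x) - init j x).coeff i = (frobenius x - x).coeff i := by
  have h : init i (init j x) = init i x := by
    ext l
    simp only [init_coeff]
    split_ifs <;> first | rfl | omega
  rw [frobenius_sub_coeff, frobenius_sub_coeff x, h, init_coeff, if_pos hij]

end WittVectors

section Valuations

variable {L : Type*} [Field L] (V : AddValuation L (WithTop ℤ))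

theorem val_mul_eq {x y : L} {a b : ℤ} (hx : V x = (a : WithTop ℤ)) (hy : V y = (b : WithTop ℤ)) :
    V (x * y) = ((a + b : ℤ) : WithTop ℤ) := by
  rw [V.map_mul, hx, hy, WithTop.coe_add]

theorem le_val_mul {x y : L} {a b : ℤ} (hx : (a : WithTop ℤ) ≤ V x) (hy : (b : WithTop ℤ) ≤ V y) :
    ((a + b : ℤ) : WithTop ℤ) ≤ V (x * y) := by
  rw [V.map_mul, WithTop.coe_add]
  exact add_le_add hx hy

theorem val_pow_eq {x : L} {a : ℤ} (hx : V x = (a : WithTop ℤ)) (k : ℕ) :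
    V (x ^ k) = ((k * a : ℤ) : WithTop ℤ) := by
  induction k with
  | zero => simp
  | succ k ih =>
    rw [pow_succ, val_mul_eq V ih hx]
    congr 1
    push_cast
    ring

theorem le_val_pow {x : L} {a : ℤ} (hx : (a : WithTop ℤ) ≤ V x) (k : ℕ) :
    ((k * a : ℤ) : WithTop ℤ) ≤ V (x ^ k) := by
  induction k with
  | zero => simp
  | succ k ih =>
    have := le_val_mul V ih hx
    rw [pow_succ]
    convert this using 2
    push_cast
    ring

theorem exists_val_eq {x : L} (hx : x ≠ 0) : ∃ a : ℤ, V x = (a : WithTop ℤ) := by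
  obtain ⟨a, ha⟩ := WithTop.ne_top_iff_exists.mp ((V.ne_top_iff).mpr hx)
  exact ⟨a, ha.symm⟩

theorem ne_zero_of_val_eq {x : L} {a : ℤ} (hx : V x = (a : WithTop ℤ)) : x ≠ 0 := by
  rintro rfl
  rw [V.map_zero] at hx
  exact WithTop.top_ne_coe hx

theorem val_inv_eq {x : L} {a : ℤ} (hx : V x = (a : WithTop ℤ)) :
    V x⁻¹ = ((-a : ℤ) : WithTop ℤ) := by
  have h0 := ne_zero_of_val_eq V hx
  obtain ⟨b, hb⟩ := exists_val_eq V (inv_ne_zero h0)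
  have h := val_mul_eq V hx hb
  rw [mul_inv_cancel₀ h0, V.map_one, ← WithTop.coe_zero, WithTop.coe_inj] at h
  rw [hb, WithTop.coe_inj]
  omega

theorem val_div_eq {x y : L} {a b : ℤ} (hx : V x = (a : WithTop ℤ)) (hy : V y = (b : WithTop ℤ)) :
    V (x / y) = ((a - b : ℤ) : WithTop ℤ) := by
  rw [div_eq_mul_inv, val_mul_eq V hx (val_inv_eq V hy), sub_eq_add_neg]

theorem le_val_div {x y : L} {a b : ℤ} (hx : (a : WithTop ℤ) ≤ V x)
    (hy : V y = (b : WithTop ℤ)) : ((a - b : ℤ) : WithTop ℤ) ≤ V (x / y) := by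
  rw [div_eq_mul_inv, sub_eq_add_neg]
  exact le_val_mul V hx (val_inv_eq V hy).ge

theorem val_intCast_eq_zero {p : ℕ} [hp : Fact p.Prime] [CharP L p] {i : ℤ} (hi : ¬ (p : ℤ) ∣ i) :
    V (i : L) = ((0 : ℤ) : WithTop ℤ) := by
  have h0 : (i : L) ≠ 0 := by rwa [Ne, CharP.intCast_eq_zero_iff L p]
  obtain ⟨a, ha⟩ := exists_val_eq V h0
  have hfin : ((i : L)) ^ (p - 1) = 1 := by
    have h1 : ((i : ZMod p)) ^ (p - 1) = 1 := ZMod.pow_card_sub_one_eq_one (by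
      rwa [Ne, ZMod.intCast_zmod_eq_zero_iff_dvd])
    have h2 := congrArg (ZMod.castHom dvd_rfl L) h1
    simpa using h2
  have h := val_pow_eq V ha (p - 1)
  rw [hfin, V.map_one, ← WithTop.coe_zero, WithTop.coe_inj] at h
  have hp2 := hp.out.two_le
  have : a = 0 := by
    rcases mul_eq_zero.mp h.symm with h | h
    · have : p - 1 = 0 := by exact_mod_cast h
      omega
    · exact h
  rw [ha, this]

theorem exists_dominant_term {ι : Type*} (s : Finset ι) (f : ι → L)
    (hd : ∀ i ∈ s, ∀ j ∈ s, i ≠ j → V (f i) = V (f j) → f i = 0) (hne : ∑ i ∈ s, f i ≠ 0) :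
    ∃ i ∈ s, f i ≠ 0 ∧ V (∑ i ∈ s, f i) = V (f i) ∧ V (f i) < V (∑ i ∈ s, f i - f i) ∧
      ∀ j ∈ s, j ≠ i → V (f i) < V (f j) := by
  classical
  have hs : s.Nonempty := by
    by_contra h
    rw [Finset.not_nonempty_iff_eq_empty] at h
    simp [h] at hne
  obtain ⟨i, hi, hmin⟩ := Finset.exists_min_image s (fun i => V (f i)) hs
  have h0 : f i ≠ 0 := by
    intro h
    refine hne (Finset.sum_eq_zero fun j hj => ?_)
    have := hmin j hj
    rw [h, V.map_zero, top_le_iff, V.top_iff] at this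
    exact this
  have hlt : ∀ j ∈ s, j ≠ i → V (f i) < V (f j) := fun j hj hji =>
    lt_of_le_of_ne (hmin j hj) fun h => h0 (hd i hi j hj hji.symm h)
  have hsum : ∑ i ∈ s, f i - f i = ∑ j ∈ s.erase i, f j := by
    rw [← Finset.add_sum_erase s f hi]
    ring
  have hrest : V (f i) < V (∑ i ∈ s, f i - f i) := by
    rw [hsum]
    refine V.map_lt_sum ((V.ne_top_iff).mpr h0) fun j hj => ?_
    exact hlt j (Finset.mem_of_mem_erase hj) (Finset.ne_of_mem_erase hj)
  exact ⟨i, hi, h0, V.map_eq_of_lt_sub hrest, hrest, hlt⟩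

theorem le_val_terms_of_le_val_sum {ι : Type*} (s : Finset ι) (f : ι → L)
    (hd : ∀ i ∈ s, ∀ j ∈ s, i ≠ j → V (f i) = V (f j) → f i = 0) {m : WithTop ℤ}
    (hm : m ≤ V (∑ i ∈ s, f i)) : ∀ i ∈ s, m ≤ V (f i) := by
  intro j hj
  by_cases hne : ∑ i ∈ s, f i = 0
  · by_cases h0 : f j = 0
    · simp [h0]
    exfalso
    have h1 : ∑ i ∈ s, f i + -f j = -f j := by rw [hne, zero_add]
    classical
    have h2 : ∑ i ∈ s.erase j, f i = -f j := by
      rw [← Finset.add_sum_erase s f hj] at hne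
      linear_combination hne
    have h3 : ∑ i ∈ s.erase j, f i ≠ 0 := by rw [h2]; exact neg_ne_zero.mpr h0
    obtain ⟨i, hi, hi0, hV, -⟩ := exists_dominant_term V (s.erase j) f
      (fun i hi l hl => hd i (Finset.mem_of_mem_erase hi) l (Finset.mem_of_mem_erase hl)) h3
    rw [h2, V.map_neg] at hV
    exact h0 (hd j hj i (Finset.mem_of_mem_erase hi) (Finset.ne_of_mem_erase hi).symm hV)
  · obtain ⟨i, hi, hi0, hV, -, hlt⟩ := exists_dominant_term V s f hd hne
    rw [hV] at hm
    by_cases hji : j = i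
    · rwa [hji]
    · exact hm.trans (hlt j hj hji).le

theorem derivation_pow_char (p : ℕ) [CharP L p] (θ : Derivation ℤ L L) (x : L) : θ (x ^ p) = 0 := by
  rw [Derivation.leibniz_pow]
  simp

/-- A subfield `F` of a field `L` of characteristic `p` with additive valuation `V` whose value
group is contained in `qℤ`, on which the derivation `θ` lowers valuations by at most `q * μ`,
with equality at the elements whose valuation is not divisible by `q * p`, and whose elements of
valuation divisible by `q * p` are approximated by `p`-th powers. -/
structure HasLogDifferent (p : ℕ) (θ : Derivation ℤ L L) (F : Subfield L) (q μ : ℤ) : Prop where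
  dvd : ∀ x ∈ F, x ≠ 0 → ∃ m : ℤ, V x = ((q * m : ℤ) : WithTop ℤ)
  le : ∀ x ∈ F, ∀ m : ℤ, V x = ((q * m : ℤ) : WithTop ℤ) →
    ((q * (m - μ) : ℤ) : WithTop ℤ) ≤ V (θ x)
  eq : ∀ x ∈ F, ∀ m : ℤ, ¬ (p : ℤ) ∣ m → V x = ((q * m : ℤ) : WithTop ℤ) →
    V (θ x) = ((q * (m - μ) : ℤ) : WithTop ℤ)
  approx : ∀ x ∈ F, ∀ m : ℤ, V x = ((q * (p * m) : ℤ) : WithTop ℤ) →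
    ∃ g ∈ F, V x < V (x - g ^ p)

variable {V}

theorem HasLogDifferent.exists_reduced {p : ℕ} [hp : Fact p.Prime] [CharP L p]
    {θ : Derivation ℤ L L} {F : Subfield L} {q μ : ℤ} (H : HasLogDifferent V p θ F q μ)
    (hq : 0 < q) {N : ℤ} (hN : 0 < N) {z : L} (hz : z ∈ F)
    (hθ : V (θ z) = ((q * (-N - μ) : ℤ) : WithTop ℤ))
    (hlow : ((q * (-(p * N)) : ℤ) : WithTop ℤ) < V z) :
    ∃ h ∈ F, V (z - (h ^ p - h)) = ((q * (-N) : ℤ) : WithTop ℤ) ∧ ¬ (p : ℤ) ∣ N := by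
  have hp2 : (2 : ℤ) ≤ p := by exact_mod_cast hp.out.two_le
  have hθw : ∀ h ∈ F, ((q * (-N) : ℤ) : WithTop ℤ) < V h →
      V (θ (z - (h ^ p - h))) = ((q * (-N - μ) : ℤ) : WithTop ℤ) := by
    intro h hh hV
    have h1 : θ (z - (h ^ p - h)) = θ z + θ h := by
      rw [map_sub, map_sub, derivation_pow_char]
      ring
    rw [h1, V.map_add_eq_of_lt_left, hθ]
    rw [hθ]
    by_cases h0 : h = 0
    · rw [h0, map_zero, V.map_zero]
      exact WithTop.coe_lt_top _
    · obtain ⟨a, ha⟩ := H.dvd h hh h0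
      refine lt_of_lt_of_le ?_ (H.le h hh a ha)
      rw [ha, WithTop.coe_lt_coe] at hV
      rw [WithTop.coe_lt_coe]
      nlinarith [lt_of_mul_lt_mul_left hV hq.le]
  have key : ∀ k : ℕ, ∀ h ∈ F, ((q * (-N) : ℤ) : WithTop ℤ) < V h → ∀ m : ℤ,
      V (z - (h ^ p - h)) = ((q * m : ℤ) : WithTop ℤ) → -(p * N) < m → -N - m ≤ k →
      ∃ h ∈ F, V (z - (h ^ p - h)) = ((q * (-N) : ℤ) : WithTop ℤ) ∧ ¬ (p : ℤ) ∣ N := by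
    intro k
    induction k with
    | zero => ?_
    | succ k ih => ?_
    all_goals
      intro h hh hVh m hm hmN hk
      have hw : z - (h ^ p - h) ∈ F := F.sub_mem hz (F.sub_mem (F.pow_mem hh p) hh)
      have hθ' := hθw h hh hVh
      by_cases hpm : (p : ℤ) ∣ m
      swap
      · have h1 := H.eq _ hw m hpm hm
        rw [hθ', WithTop.coe_inj] at h1
        have h2 : m = -N := by
          have := mul_left_cancel₀ hq.ne' h1
          omega
        refine ⟨h, hh, h2 ▸ hm, fun hd => hpm ?_⟩
        rw [h2]
        exact (dvd_neg).mpr hd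
      obtain ⟨m', rfl⟩ := hpm
      obtain ⟨g, hg, hlt⟩ := H.approx _ hw m' hm
      have hθg : θ (z - (h ^ p - h) - g ^ p) = θ (z - (h ^ p - h)) := by
        rw [map_sub, derivation_pow_char, sub_zero]
      have hne : z - (h ^ p - h) - g ^ p ≠ 0 := by
        intro h0
        rw [← hθg, h0, map_zero, V.map_zero] at hθ'
        exact WithTop.top_ne_coe hθ'
      obtain ⟨c, hc⟩ := H.dvd _ (F.sub_mem hw (F.pow_mem hg p)) hne
      have hcN : c ≤ -N := by
        have h1 := H.le _ (F.sub_mem hw (F.pow_mem hg p)) c hc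
        rw [hθg, hθ', WithTop.coe_le_coe] at h1
        have := le_of_mul_le_mul_left h1 hq
        omega
      have hmc : p * m' < c := by
        rw [hm, hc, WithTop.coe_lt_coe] at hlt
        exact lt_of_mul_lt_mul_left hlt hq.le
      have hmN' : -N < m' := by nlinarith
      have hm'0 : m' < 0 := by nlinarith
      have hm'm : p * m' < m' := by nlinarith
      have hgp : V (g ^ p) = ((q * (p * m') : ℤ) : WithTop ℤ) := by
        rw [← hm]
        apply V.map_eq_of_lt_sub
        rwa [V.map_sub_swap (g ^ p)]
      have hVg : V g = ((q * m' : ℤ) : WithTop ℤ) := by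
        have hg0 : g ≠ 0 := by
          intro h0
          rw [h0, zero_pow hp.out.ne_zero, V.map_zero] at hgp
          exact WithTop.top_ne_coe hgp
        obtain ⟨b, hb⟩ := H.dvd g hg hg0
        rw [val_pow_eq V hb, WithTop.coe_inj] at hgp
        rw [hb, WithTop.coe_inj]
        apply mul_left_cancel₀ (show (p : ℤ) ≠ 0 by omega)
        linear_combination hgp
    · omega
    · have hVhg : ((q * (-N) : ℤ) : WithTop ℤ) < V (h + g) := by
        refine V.map_lt_add hVh ?_
        rw [hVg, WithTop.coe_lt_coe]
        exact mul_lt_mul_of_pos_left hmN' hq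
      have hθ'' := hθw (h + g) (F.add_mem hh hg) hVhg
      have hne' : z - ((h + g) ^ p - (h + g)) ≠ 0 := by
        intro h0
        rw [h0, map_zero, V.map_zero] at hθ''
        exact WithTop.top_ne_coe hθ''
      have hmem : z - ((h + g) ^ p - (h + g)) ∈ F :=
        F.sub_mem hz (F.sub_mem (F.pow_mem (F.add_mem hh hg) p) (F.add_mem hh hg))
      obtain ⟨m₁, hm₁⟩ := H.dvd _ hmem hne'
      have hm₁m : p * m' < m₁ := by
        have h1 : z - ((h + g) ^ p - (h + g)) = (z - (h ^ p - h) - g ^ p) + g := by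
          rw [add_pow_char]
          ring
        have h2 : ((q * (p * m') : ℤ) : WithTop ℤ) < V (z - ((h + g) ^ p - (h + g))) := by
          rw [h1]
          refine V.map_lt_add ?_ ?_
          · rw [hc, WithTop.coe_lt_coe]
            exact mul_lt_mul_of_pos_left hmc hq
          · rw [hVg, WithTop.coe_lt_coe]
            exact mul_lt_mul_of_pos_left hm'm hq
        rw [hm₁, WithTop.coe_lt_coe] at h2
        exact lt_of_mul_lt_mul_left h2 hq.le
      refine ih (h + g) (F.add_mem hh hg) hVhg m₁ hm₁ (by omega) ?_
      push_cast at hk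
      omega
  have hz0 : z ≠ 0 := by
    rintro rfl
    rw [map_zero, V.map_zero] at hθ
    exact WithTop.top_ne_coe hθ
  obtain ⟨m, hm⟩ := H.dvd z hz hz0
  refine key (-N - m).toNat 0 F.zero_mem (by rw [V.map_zero]; exact WithTop.coe_lt_top _) m ?_ ?_ ?_
  · simpa [zero_pow hp.out.ne_zero] using hm
  · rw [hm, WithTop.coe_lt_coe] at hlow
    exact lt_of_mul_lt_mul_left hlow hq.le
  · omega

end Valuations

section Extension

variable {L : Type*} [Field L] {V : AddValuation L (WithTop ℤ)}

theorem exists_nat_dvd_sub_mul {p : ℕ} [hp : Fact p.Prime] {N : ℤ} (hN : ¬ (p : ℤ) ∣ N) (m : ℤ) :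
    ∃ l : ℕ, (p : ℤ) ∣ m - l * N := by
  refine ⟨((m : ZMod p) / (N : ZMod p)).val, ?_⟩
  have h0 : (N : ZMod p) ≠ 0 := by rwa [Ne, ZMod.intCast_zmod_eq_zero_iff_dvd]
  rw [← ZMod.intCast_zmod_eq_zero_iff_dvd]
  push_cast
  rw [ZMod.natCast_zmod_val, div_mul_cancel₀ _ h0, sub_self]

theorem val_one_sub_pow_pos {w : L} (hw : 0 < V (1 - w)) (l : ℕ) : 0 < V (1 - w ^ l) := by
  have h1 : V w = 0 := by
    rw [← V.map_one]
    apply V.map_eq_of_lt_sub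
    rw [V.map_one, V.map_sub_swap]
    exact hw
  induction l with
  | zero =>
    rw [pow_zero, sub_self, V.map_zero]
    exact WithTop.coe_lt_top 0
  | succ l ih =>
    have : 1 - w ^ (l + 1) = (1 - w ^ l) + w ^ l * (1 - w) := by ring
    rw [this]
    refine V.map_lt_add ih ?_
    rw [V.map_mul, V.map_pow, h1, smul_zero, zero_add]
    exact hw

theorem val_artinSchreier_root {p : ℕ} [hp : Fact p.Prime] {x : L} {c : ℤ} (hc : c < 0)
    (h : V (x ^ p - x) = ((p * c : ℤ) : WithTop ℤ)) : V x = (c : WithTop ℤ) := by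
  have hp2 : (2 : ℤ) ≤ p := by exact_mod_cast hp.out.two_le
  have hx0 : x ≠ 0 := by
    rintro rfl
    rw [zero_pow hp.out.ne_zero, sub_zero, V.map_zero] at h
    exact WithTop.top_ne_coe h
  obtain ⟨b, hb⟩ := exists_val_eq V hx0
  have hbp := val_pow_eq V hb p
  have hb0 : b < 0 := by
    by_contra hb0
    push Not at hb0
    have h1 : ((0 : ℤ) : WithTop ℤ) ≤ V (x ^ p - x) := by
      refine V.map_le_sub ?_ ?_
      · rw [hbp, WithTop.coe_le_coe]; positivity
      · rw [hb, WithTop.coe_le_coe]; exact hb0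
    rw [h, WithTop.coe_le_coe] at h1
    nlinarith
  have h2 : V (x ^ p - x) = V (x ^ p) := by
    apply V.map_eq_of_lt_sub
    rw [sub_sub_cancel_left, V.map_neg, hb, hbp, WithTop.coe_lt_coe]
    nlinarith
  rw [h, hbp, WithTop.coe_inj] at h2
  rw [hb, WithTop.coe_inj]
  exact (mul_left_cancel₀ (by omega) h2).symm

theorem HasLogDifferent.extend {p : ℕ} [hp : Fact p.Prime] [CharP L p]
    {θ : Derivation ℤ L L} {F F' : Subfield L} {q μ : ℤ} (H : HasLogDifferent V p θ F (p * q) μ)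
    (hq : 0 < q) {N : ℤ} (hN : 0 < N) (hpN : ¬ (p : ℤ) ∣ N) {x : L} (hx : x ∈ F')
    (hr : x ^ p - x ∈ F) (hVr : V (x ^ p - x) = ((p * q * (-N) : ℤ) : WithTop ℤ)) (hle : F ≤ F')
    (hspan : ∀ z ∈ F', ∃ a : ℕ → L, (∀ i, a i ∈ F) ∧ z = ∑ i ∈ Finset.range p, a i * x ^ i) :
    HasLogDifferent V p θ F' q (p * μ + (p - 1) * N) := by
  have hp2 : (2 : ℤ) ≤ p := by exact_mod_cast hp.out.two_le
  have hpZ : Prime (p : ℤ) := Nat.prime_iff_prime_int.mp hp.out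
  have hVx : V x = ((q * (-N) : ℤ) : WithTop ℤ) := by
    refine val_artinSchreier_root (p := p) (by nlinarith) ?_
    rw [hVr, mul_assoc]
  have hx0 : x ≠ 0 := ne_zero_of_val_eq V hVx
  have hθx : V (θ x) = ((p * q * (-N - μ) : ℤ) : WithTop ℤ) := by
    have h1 := H.eq _ hr (-N) (by rwa [dvd_neg]) hVr
    rw [map_sub, derivation_pow_char, zero_sub, V.map_neg] at h1
    exact h1
  -- valuations of the monomials `a * x ^ i`
  have hterm : ∀ a ∈ F, ∀ i : ℕ, a ≠ 0 → ∃ α : ℤ, V a = ((p * q * α : ℤ) : WithTop ℤ) ∧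
      V (a * x ^ i) = ((q * (p * α - i * N) : ℤ) : WithTop ℤ) := by
    intro a ha i ha0
    obtain ⟨α, hα⟩ := H.dvd a ha ha0
    refine ⟨α, hα, ?_⟩
    rw [val_mul_eq V hα (val_pow_eq V hVx i)]
    congr 1
    ring
  have hdist : ∀ a ∈ F, ∀ b ∈ F, ∀ i < p, ∀ j < p, i ≠ j → V (a * x ^ i) = V (b * x ^ j) →
      a * x ^ i = 0 := by
    intro a ha b hb i hi j hj hij h
    by_contra h0
    have ha0 : a ≠ 0 := fun h => h0 (by rw [h, zero_mul])
    have hb0 : b ≠ 0 := by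
      rintro rfl
      rw [zero_mul, V.map_zero, V.top_iff] at h
      exact h0 h
    obtain ⟨α, -, hα⟩ := hterm a ha i ha0
    obtain ⟨β, -, hβ⟩ := hterm b hb j hb0
    rw [hα, hβ, WithTop.coe_inj] at h
    have h1 := mul_left_cancel₀ hq.ne' h
    have h2 : (p : ℤ) ∣ ((i : ℤ) - j) * N := ⟨α - β, by linear_combination -h1⟩
    have h3 := (hpZ.dvd_or_dvd h2).resolve_right hpN
    have h4 := Int.eq_zero_of_abs_lt_dvd h3 (by rw [abs_lt]; omega)
    omega
  have hθterm : ∀ a ∈ F, ∀ i < p, ∀ e : ℤ, V (a * x ^ i) = ((q * e : ℤ) : WithTop ℤ) →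
      ((q * (e - (p * μ + (p - 1) * N)) : ℤ) : WithTop ℤ) ≤ V (θ (a * x ^ i)) ∧
      (i ≠ 0 → V (θ (a * x ^ i)) =
        ((q * (e - (p * μ + (p - 1) * N)) : ℤ) : WithTop ℤ)) := by
    intro a ha i hi e he
    have ha0 : a ≠ 0 := by
      rintro rfl
      rw [zero_mul, V.map_zero] at he
      exact WithTop.top_ne_coe he
    obtain ⟨α, hα, hα'⟩ := hterm a ha i ha0
    rw [hα', WithTop.coe_inj] at he
    obtain rfl := mul_left_cancel₀ hq.ne' he
    have hpN' : 0 < ((p : ℤ) - 1) * N := mul_pos (by omega) hN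
    have h1 : ((q * (p * α - i * N - (p * μ + (p - 1) * N)) : ℤ) : WithTop ℤ) <
        V (x ^ i * θ a) := by
      refine lt_of_lt_of_le ?_ (le_val_mul V (val_pow_eq V hVx i).ge (H.le a ha α hα))
      rw [WithTop.coe_lt_coe]
      nlinarith
    have h2 : θ (a * x ^ i) = x ^ i * θ a + a * ((i : L) * (x ^ (i - 1) * θ x)) := by
      rw [Derivation.leibniz, Derivation.leibniz_pow]
      simp only [smul_eq_mul, nsmul_eq_mul]
      ring
    by_cases hi0 : i = 0
    · refine ⟨?_, fun h => absurd hi0 h⟩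
      subst hi0
      rw [h2]
      simpa using h1.le
    · have h3 : V ((i : L)) = ((0 : ℤ) : WithTop ℤ) := by
        have := val_intCast_eq_zero V (p := p) (i := (i : ℤ)) (by
          intro hd
          have := Int.le_of_dvd (by omega) hd
          omega)
        simpa using this
      have h4 : V (a * ((i : L) * (x ^ (i - 1) * θ x))) =
          ((q * (p * α - i * N - (p * μ + (p - 1) * N)) : ℤ) : WithTop ℤ) := by
        rw [val_mul_eq V hα (val_mul_eq V h3 (val_mul_eq V (val_pow_eq V hVx (i - 1)) hθx))]
        congr 1
        rw [Nat.cast_sub (by omega)]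
        push_cast
        ring
      have h5 : V (θ (a * x ^ i)) =
          ((q * (p * α - i * N - (p * μ + (p - 1) * N)) : ℤ) : WithTop ℤ) := by
        rw [h2, V.map_add_eq_of_lt_right, h4]
        rw [h4]
        exact h1
      exact ⟨h5.ge, fun _ => h5⟩
  have hdom : ∀ z ∈ F', z ≠ 0 → ∃ a : ℕ → L, (∀ i, a i ∈ F) ∧
      z = ∑ i ∈ Finset.range p, a i * x ^ i ∧ ∃ i < p, ∃ α : ℤ,
      V (a i) = ((p * q * α : ℤ) : WithTop ℤ) ∧
      V (a i * x ^ i) = ((q * (p * α - i * N) : ℤ) : WithTop ℤ) ∧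
      V z = ((q * (p * α - i * N) : ℤ) : WithTop ℤ) ∧
      V z < V (z - a i * x ^ i) ∧
      ∀ j ∈ Finset.range p, j ≠ i → V z < V (a j * x ^ j) := by
    intro z hz hz0
    obtain ⟨a, ha, rfl⟩ := hspan z hz
    obtain ⟨i, hi, hi0, hV, hlt, hlt'⟩ := exists_dominant_term V (Finset.range p)
      (fun i => a i * x ^ i) (fun i hi j hj hij h => hdist _ (ha i) _ (ha j) i
        (Finset.mem_range.mp hi) j (Finset.mem_range.mp hj) hij h) hz0
    obtain ⟨α, hα, hα'⟩ := hterm (a i) (ha i) i (fun h => hi0 (by rw [h, zero_mul]))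
    refine ⟨a, ha, rfl, i, Finset.mem_range.mp hi, α, hα, hα', by rw [hV, hα'], ?_, ?_⟩
    · rw [hV]; exact hlt
    · intro j hj hji
      rw [hV]
      exact hlt' j hj hji
  refine ⟨?_, ?_, ?_, ?_⟩
  · intro z hz hz0
    obtain ⟨a, ha, -, i, hi, α, -, -, hV, -⟩ := hdom z hz hz0
    exact ⟨_, hV⟩
  · intro z hz m hm
    obtain ⟨a, ha, rfl⟩ := hspan z hz
    rw [map_sum]
    refine V.map_le_sum fun j hj => ?_
    have h1 := le_val_terms_of_le_val_sum V (Finset.range p)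
      (fun i => a i * x ^ i) (fun i hi j hj hij h => hdist _ (ha i) _ (ha j) i
        (Finset.mem_range.mp hi) j (Finset.mem_range.mp hj) hij h) hm.ge j hj
    by_cases h0 : a j = 0
    · simp [h0]
    · obtain ⟨α, -, hα⟩ := hterm (a j) (ha j) j h0
      refine le_trans ?_ (hθterm (a j) (ha j) j (Finset.mem_range.mp hj) _ hα).1
      rw [hα, WithTop.coe_le_coe] at h1
      rw [WithTop.coe_le_coe]
      have := le_of_mul_le_mul_left h1 hq
      exact mul_le_mul_of_nonneg_left (by omega) hq.le
  · intro z hz m hpm hm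
    obtain ⟨a, ha, hza, i, hi, α, hα, hα', hV, -, hlt⟩ := hdom z hz (ne_zero_of_val_eq V hm)
    rw [hV, WithTop.coe_inj] at hm
    obtain rfl := mul_left_cancel₀ hq.ne' hm
    have hi0 : i ≠ 0 := by
      rintro rfl
      exact hpm ⟨α, by push_cast; ring⟩
    have h1 := (hθterm (a i) (ha i) i hi _ hα').2 hi0
    rw [← h1]
    apply V.map_eq_of_lt_sub
    have h2 : θ z - θ (a i * x ^ i) = ∑ j ∈ (Finset.range p).erase i, θ (a j * x ^ j) := by
      rw [hza, map_sum, ← Finset.add_sum_erase _ _ (Finset.mem_range.mpr hi)]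
      ring
    rw [h2, h1]
    refine V.map_lt_sum (WithTop.coe_ne_top) fun j hj => ?_
    by_cases h0 : a j = 0
    · rw [h0, zero_mul, map_zero, V.map_zero]
      exact WithTop.coe_lt_top _
    · obtain ⟨β, -, hβ⟩ := hterm (a j) (ha j) j h0
      have hjp := Finset.mem_range.mp (Finset.mem_of_mem_erase hj)
      refine lt_of_lt_of_le ?_ (hθterm (a j) (ha j) j hjp _ hβ).1
      have h3 := hlt j (Finset.mem_of_mem_erase hj) (Finset.ne_of_mem_erase hj)
      rw [hV, hβ, WithTop.coe_lt_coe] at h3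
      rw [WithTop.coe_lt_coe]
      have := lt_of_mul_lt_mul_left h3 hq.le
      exact mul_lt_mul_of_pos_left (by omega) hq
  · intro z hz m hm
    obtain ⟨a, ha, hza, i, hi, α, hα, hα', hV, hlt, -⟩ := hdom z hz (ne_zero_of_val_eq V hm)
    have h0 := hV
    rw [hm, WithTop.coe_inj] at h0
    have h1 := mul_left_cancel₀ hq.ne' h0
    have hi0 : i = 0 := by
      have h2 : (p : ℤ) ∣ (i : ℤ) * N := ⟨α - m, by linear_combination h1⟩
      have h3 := (hpZ.dvd_or_dvd h2).resolve_right hpN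
      by_contra hne
      have := Int.le_of_dvd (by omega) h3
      omega
    subst hi0
    have hαm : α = m := by
      apply mul_left_cancel₀ (show (p : ℤ) ≠ 0 by omega)
      rw [h1]
      push_cast
      ring
    subst hαm
    rw [pow_zero, mul_one] at hlt
    obtain ⟨l, γ, hl⟩ := exists_nat_dvd_sub_mul hpN α
    have hb : V (a 0 * (x ^ p - x) ^ l) = ((p * q * (p * γ) : ℤ) : WithTop ℤ) := by
      rw [val_mul_eq V hα (val_pow_eq V hVr l), ← hl]
      congr 1
      ring
    obtain ⟨g, hg, hgb⟩ := H.approx _ (F.mul_mem (ha 0) (F.pow_mem hr l)) γ hb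
    refine ⟨g / x ^ l, F'.div_mem (hle hg) (F'.pow_mem hx l), ?_⟩
    have hxl : V (x ^ (p * l)) = ((p * q * (l * (-N)) : ℤ) : WithTop ℤ) := by
      rw [val_pow_eq V hVx]
      congr 1
      push_cast
      ring
    have hdec : z - (g / x ^ l) ^ p = (z - a 0) + (a 0 * (1 - ((x ^ p - x) / x ^ p) ^ l) +
        (a 0 * (x ^ p - x) ^ l - g ^ p) / x ^ (p * l)) := by
      rw [div_pow, div_pow, ← pow_mul, ← pow_mul, mul_comm l p, sub_div _ (g ^ p)]
      ring
    rw [hdec]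
    refine V.map_lt_add hlt (V.map_lt_add ?_ ?_)
    · have h2 : (0 : WithTop ℤ) < V (1 - (x ^ p - x) / x ^ p) := by
        have h3 : 1 - (x ^ p - x) / x ^ p = x / x ^ p := by field_simp; ring
        rw [h3, val_div_eq V hVx (val_pow_eq V hVx p), ← WithTop.coe_zero, WithTop.coe_lt_coe]
        have : 0 < (p - 1) * (q * N) := mul_pos (by omega) (mul_pos hq hN)
        linarith
      have h4 := val_one_sub_pow_pos h2 l
      rw [V.map_mul, hα, hm]
      by_cases h5 : (1 - ((x ^ p - x) / x ^ p) ^ l) = 0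
      · rw [h5, V.map_zero, WithTop.add_top]
        exact WithTop.coe_lt_top _
      · obtain ⟨e, he⟩ := exists_val_eq V h5
        rw [he, ← WithTop.coe_zero, WithTop.coe_lt_coe] at h4
        rw [he, ← WithTop.coe_add, WithTop.coe_lt_coe]
        linarith
    · by_cases h5 : a 0 * (x ^ p - x) ^ l - g ^ p = 0
      · rw [h5, zero_div, V.map_zero, hm]
        exact WithTop.coe_lt_top _
      · obtain ⟨e, he⟩ := exists_val_eq V h5
        rw [hb, he, WithTop.coe_lt_coe, ← hl] at hgb
        rw [val_div_eq V he hxl, hm, WithTop.coe_lt_coe]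
        linarith

end Extension

section Bounds

open WittVector

/-- The maximum of `p ^ (j - 1 - i) * ν i` over `i < j`. -/
def maxPole (p : ℕ) (ν : ℕ → ℕ) (j : ℕ) : ℕ :=
  (Finset.range j).sup fun i => p ^ (j - 1 - i) * ν i

theorem maxPole_zero (p : ℕ) (ν : ℕ → ℕ) : maxPole p ν 0 = 0 := by simp [maxPole]

theorem maxPole_succ (p : ℕ) (ν : ℕ → ℕ) (j : ℕ) :
    maxPole p ν (j + 1) = max (p * maxPole p ν j) (ν j) := by
  rw [maxPole, Finset.range_add_one, Finset.sup_insert, max_comm]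
  simp only [Nat.add_sub_cancel, Nat.sub_self, pow_zero, one_mul]
  congr 1
  rw [maxPole, Finset.apply_sup_eq_sup_comp (fun x => p * x)
    (fun a b => Nat.mul_max_mul_left p a b |>.symm)
    (mul_zero p)]
  refine Finset.sup_congr rfl fun i hi => ?_
  have := Finset.mem_range.mp hi
  rw [Function.comp_apply, ← mul_assoc, ← pow_succ']
  congr 2
  omega

theorem pow_mul_maxPole_le (p : ℕ) (ν : ℕ → ℕ) (i d : ℕ) :
    p ^ d * maxPole p ν i ≤ maxPole p ν (i + d) := by
  induction d with
  | zero => simp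
  | succ d ih =>
    rw [pow_succ', mul_assoc, ← add_assoc, maxPole_succ]
    exact (Nat.mul_le_mul_left p ih).trans (le_max_left _ _)

theorem maxPole_pos {p : ℕ} (hp : 0 < p) {ν : ℕ → ℕ} (hν : 0 < ν 0) {j : ℕ} (hj : 1 ≤ j) :
    0 < maxPole p ν j := by
  have h1 := pow_mul_maxPole_le p ν 1 (j - 1)
  rw [maxPole_succ, maxPole_zero, mul_zero, Nat.add_sub_cancel' hj] at h1
  refine lt_of_lt_of_le ?_ h1
  simp only [zero_le, sup_of_le_right]
  positivity

variable {L : Type*} [Field L] {V : AddValuation L (WithTop ℤ)}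

theorem val_add_eq_neg_max {x y : L} {a b : ℤ} (hab : a ≠ b)
    (hx : V x = ((-a : ℤ) : WithTop ℤ)) (hy : V y = ((-b : ℤ) : WithTop ℤ)) :
    V (x + y) = ((-(max a b) : ℤ) : WithTop ℤ) := by
  rcases lt_or_gt_of_ne hab with h | h
  · rw [V.map_add_eq_of_lt_right, hy, max_eq_right h.le]
    rw [hx, hy, WithTop.coe_lt_coe]
    omega
  · rw [V.map_add_eq_of_lt_left, hx, max_eq_left h.le]
    rw [hx, hy, WithTop.coe_lt_coe]
    omega

/-- The ring of elements of nonnegative valuation. -/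
def nonnegSubring (V : AddValuation L (WithTop ℤ)) : Subring L where
  carrier := {x | 0 ≤ V x}
  mul_mem' {x y} hx hy := by
    simp only [Set.mem_ofPred_eq] at *
    rw [V.map_mul]
    exact add_nonneg hx hy
  one_mem' := by simp
  add_mem' {x y} hx hy := V.map_le_add hx hy
  zero_mem' := by simp
  neg_mem' {x} hx := by simpa using hx

theorem mem_nonnegSubring {x : L} : x ∈ nonnegSubring V ↔ 0 ≤ V x := Iff.rfl

variable {p : ℕ} [hp : Fact p.Prime] {n : ℕ} {ν : ℕ → ℕ} {θ : Derivation ℤ L L}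
  {Y : WittVector p L}

theorem le_val_of_le_val_artinSchreier {x : L} {c : ℤ} (hc : 0 ≤ c)
    (h : ((-(p * c) : ℤ) : WithTop ℤ) ≤ V (x ^ p - x)) : ((-c : ℤ) : WithTop ℤ) ≤ V x := by
  by_contra hlt
  push Not at hlt
  have hp2 : (2 : ℤ) ≤ p := by exact_mod_cast hp.out.two_le
  have hx0 : x ≠ 0 := by
    rintro rfl
    rw [V.map_zero] at hlt
    exact not_top_lt hlt
  obtain ⟨b, hb⟩ := exists_val_eq V hx0
  rw [hb, WithTop.coe_lt_coe] at hlt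
  have h2 : V (x ^ p - x) = V (x ^ p) := by
    apply V.map_eq_of_lt_sub
    rw [sub_sub_cancel_left, V.map_neg, hb, val_pow_eq V hb, WithTop.coe_lt_coe]
    nlinarith
  rw [h2, val_pow_eq V hb, WithTop.coe_le_coe] at h
  nlinarith

theorem val_sum_pow_mul_derivation {U : ℕ → L} {j : ℕ}
    (hν : ∀ i < j, 0 < ν i ∧ ¬ p ∣ ν i)
    (hU : ∀ i < j, V (U i) = ((-(p ^ n * ν i) : ℤ) : WithTop ℤ))
    (hθU : ∀ i < j, V (θ (U i)) = ((-(p ^ n * ν i) : ℤ) : WithTop ℤ)) :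
    ∀ l, 1 ≤ l → l ≤ j → V (∑ i ∈ Finset.range l, U i ^ (p ^ (j - i) - 1) * θ (U i)) =
      ((-(p ^ n * p ^ (j - l + 1) * maxPole p ν l) : ℤ) : WithTop ℤ) := by
  have hterm : ∀ i < j, V (U i ^ (p ^ (j - i) - 1) * θ (U i)) =
      ((-(p ^ n * p ^ (j - i) * ν i) : ℤ) : WithTop ℤ) := by
    intro i hi
    rw [val_mul_eq V (val_pow_eq V (hU i hi) _) (hθU i hi),
      Nat.cast_sub (Nat.one_le_pow _ _ hp.out.pos)]
    congr 1
    push_cast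
    ring
  intro l hl
  induction l, hl using Nat.le_induction with
  | base =>
    intro hj
    rw [Finset.sum_range_one, hterm 0 (by omega), maxPole_succ, maxPole_zero]
    congr 1
    rw [show j - 1 + 1 = j - 0 by omega]
    simp
  | succ l hl ih =>
    intro hlj
    rw [Finset.sum_range_succ, val_add_eq_neg_max ?_ (ih (by omega)) (hterm l (by omega)),
      maxPole_succ]
    · congr 1
      rw [show j - (l + 1) + 1 = j - l by omega]
      push_cast
      rw [pow_succ, show (p : ℤ) ^ n * (p ^ (j - l) * p) * maxPole p ν l =
        p ^ n * p ^ (j - l) * (p * maxPole p ν l) by ring,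
        ← mul_max_of_nonneg _ _ (by positivity)]
    · intro h
      have h0 : (p : ℤ) ^ n * p ^ (j - l) ≠ 0 := by
        have := hp.out.ne_zero
        positivity
      have h1 : (p : ℤ) * maxPole p ν l = ν l := by
        apply mul_left_cancel₀ h0
        rw [← h]
        ring
      exact (hν l (by omega)).2 ⟨maxPole p ν l, by exact_mod_cast h1.symm⟩

variable [CharP L p]

theorem le_val_sub_coeff {t : L} (ht : V t = ((1 : ℤ) : WithTop ℤ)) {x y : WittVector p L} (w : ℕ)
    (hx : ∀ i, ((-(w * p ^ i) : ℤ) : WithTop ℤ) ≤ V (x.coeff i))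
    (hy : ∀ i, ((-(w * p ^ i) : ℤ) : WithTop ℤ) ≤ V (y.coeff i)) (j : ℕ) :
    ((-(w * p ^ j) : ℤ) : WithTop ℤ) ≤ V ((x - y).coeff j) := by
  have hc : ∀ i, V ((t ^ w) ^ p ^ i) = ((w * p ^ i : ℤ) : WithTop ℤ) := by
    intro i
    rw [← pow_mul, val_pow_eq V ht]
    push_cast
    rw [mul_one]
  have hmem : ∀ z : WittVector p L, (∀ i, ((-(w * p ^ i) : ℤ) : WithTop ℤ) ≤ V (z.coeff i)) →
      ∀ i, (teichmuller p (t ^ w) * z).coeff i ∈ nonnegSubring V := by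
    intro z hz i
    rw [mem_nonnegSubring, teichmuller_mul_coeff]
    have := le_val_mul V (hc i).ge (hz i)
    rwa [add_neg_cancel, WithTop.coe_zero] at this
  have h := coeff_sub_mem _ (hmem x hx) (hmem y hy) j
  rw [← mul_sub, teichmuller_mul_coeff, mem_nonnegSubring] at h
  have h2 := le_val_div V (x := (t ^ w) ^ p ^ j * (x - y).coeff j) (a := 0) (by simpa using h)
    (hc j)
  rwa [mul_div_cancel_left₀ _ (ne_zero_of_val_eq V (hc j)), zero_sub] at h2

theorem le_val_carry {t : L} (ht : V t = ((1 : ℤ) : WithTop ℤ)) {j : ℕ} (hj : j ≤ n)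
    (hn : 1 ≤ n)
    (hY : ∀ i < j, ((-(p ^ (n - 1) * maxPole p ν (i + 1)) : ℤ) : WithTop ℤ) ≤ V (Y.coeff i)) :
    ((-(p ^ (n + 1) * maxPole p ν j) : ℤ) : WithTop ℤ) ≤
      V ((frobenius (init j Y) - init j Y).coeff j) := by
  have hp1 : 1 ≤ p := hp.out.one_le
  have key : ∀ i < j, ((-((p ^ (n - j) * maxPole p ν j : ℕ) * p ^ i) : ℤ) : WithTop ℤ) ≤
      V (Y.coeff i) := by
    intro i hi
    refine le_trans ?_ (hY i hi)
    rw [WithTop.coe_le_coe, neg_le_neg_iff]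
    have h1 := pow_mul_maxPole_le p ν (i + 1) (j - (i + 1))
    rw [Nat.add_sub_cancel' hi] at h1
    have h2 : p ^ (n - 1) * maxPole p ν (i + 1) ≤ (p ^ (n - j) * maxPole p ν j) * p ^ i := by
      calc p ^ (n - 1) * maxPole p ν (i + 1)
          = p ^ (n - j) * p ^ i * (p ^ (j - (i + 1)) * maxPole p ν (i + 1)) := by
            rw [← mul_assoc, ← pow_add, ← pow_add]
            congr 2
            omega
        _ ≤ p ^ (n - j) * p ^ i * maxPole p ν j := Nat.mul_le_mul_left _ h1
        _ = _ := by ring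
    exact_mod_cast h2
  have h := le_val_sub_coeff ht (x := frobenius (init j Y)) (y := init j Y)
    (p ^ (n - j + 1) * maxPole p ν j) ?_ ?_ j
  · convert h using 2
    push_cast
    rw [show n + 1 = n - j + 1 + j by omega, pow_add _ _ j]
    ring
  · intro i
    rw [coeff_frobenius_charP, init_coeff]
    split_ifs with hi
    · refine le_trans ?_ (le_val_pow V (key i hi) p)
      rw [WithTop.coe_le_coe]
      push_cast
      apply le_of_eq
      ring
    · rw [zero_pow hp.out.ne_zero, V.map_zero]
      exact le_top
  · intro i
    rw [init_coeff]
    split_ifs with hi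
    · refine le_trans ?_ (key i hi)
      rw [WithTop.coe_le_coe, neg_le_neg_iff]
      have : (p ^ (n - j) * maxPole p ν j) * p ^ i ≤
          (p ^ (n - j + 1) * maxPole p ν j) * p ^ i := by
        gcongr
        omega
      exact_mod_cast this
    · rw [V.map_zero]
      exact le_top

theorem derivation_carry (θ : Derivation ℤ L L) (Y : WittVector p L) (j : ℕ) :
    θ ((frobenius (init j Y) - init j Y).coeff j) =
      -(∑ i ∈ Finset.range j, (frobenius Y - Y).coeff i ^ (p ^ (j - i) - 1) *
          θ ((frobenius Y - Y).coeff i)) -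
        ∑ i ∈ Finset.range j, Y.coeff i ^ (p ^ (j - i) - 1) * θ (Y.coeff i) := by
  have h := wittDlog_add θ j (frobenius (init j Y) - init j Y) (init j Y)
  rw [sub_add_cancel, wittDlog_frobenius, wittDlog, wittDlog, Finset.sum_range_succ,
    Finset.sum_range_succ] at h
  have h1 : ∀ i ∈ Finset.range j, (frobenius (init j Y) - init j Y).coeff i ^ (p ^ (j - i) - 1) •
      θ ((frobenius (init j Y) - init j Y).coeff i) =
      (frobenius Y - Y).coeff i ^ (p ^ (j - i) - 1) * θ ((frobenius Y - Y).coeff i) := by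
    intro i hi
    rw [frobenius_sub_coeff_of_init _ (Finset.mem_range.mp hi), smul_eq_mul]
  have h2 : ∀ i ∈ Finset.range j, (init j Y).coeff i ^ (p ^ (j - i) - 1) •
      θ ((init j Y).coeff i) = Y.coeff i ^ (p ^ (j - i) - 1) * θ (Y.coeff i) := by
    intro i hi
    rw [init_coeff, if_pos (Finset.mem_range.mp hi), smul_eq_mul]
  rw [Finset.sum_congr rfl h1, Finset.sum_congr rfl h2] at h
  simp only [Nat.sub_self, pow_zero, one_smul, init_coeff, lt_irrefl, if_false, map_zero,
    smul_zero, add_zero] at h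
  linear_combination -h

theorem val_derivation_carry {j : ℕ} (hj : j ≤ n) (hj1 : 1 ≤ j)
    (hν : ∀ i < j, 0 < ν i ∧ ¬ p ∣ ν i)
    (hU : ∀ i < j, V ((frobenius Y - Y).coeff i) = ((-(p ^ n * ν i) : ℤ) : WithTop ℤ))
    (hθU : ∀ i < j, V (θ ((frobenius Y - Y).coeff i)) = ((-(p ^ n * ν i) : ℤ) : WithTop ℤ))
    (hY : ∀ i < j, ((-(p ^ (n - 1) * maxPole p ν (i + 1)) : ℤ) : WithTop ℤ) ≤ V (Y.coeff i))
    (hθY : ∀ i < j, V (θ (Y.coeff i)) = ((-(p ^ n * maxPole p ν (i + 1)) : ℤ) : WithTop ℤ)) :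
    V (θ ((frobenius (init j Y) - init j Y).coeff j)) =
      ((-(p ^ (n + 1) * maxPole p ν j) : ℤ) : WithTop ℤ) := by
  have hmain : V (-(∑ i ∈ Finset.range j, (frobenius Y - Y).coeff i ^ (p ^ (j - i) - 1) *
          θ ((frobenius Y - Y).coeff i))) =
      ((-(p ^ (n + 1) * maxPole p ν j) : ℤ) : WithTop ℤ) := by
    rw [V.map_neg, val_sum_pow_mul_derivation hν hU hθU j hj1 le_rfl]
    congr 1
    rw [Nat.sub_self, zero_add, pow_one, pow_succ]
  have hrest : ((-(p ^ (n + 1) * maxPole p ν j) : ℤ) : WithTop ℤ) <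
      V (∑ i ∈ Finset.range j, Y.coeff i ^ (p ^ (j - i) - 1) * θ (Y.coeff i)) := by
    refine V.map_lt_sum WithTop.coe_ne_top fun i hi => ?_
    have hi := Finset.mem_range.mp hi
    refine lt_of_lt_of_le ?_ (le_val_mul V (le_val_pow V (hY i hi) _) (hθY i hi).ge)
    have hp2 : (2 : ℤ) ≤ p := by exact_mod_cast hp.out.two_le
    have hm : (0 : ℤ) < maxPole p ν j := by
      exact_mod_cast maxPole_pos hp.out.pos (hν 0 (by omega)).1 hj1
    have h1 : (p : ℤ) ^ (j - (i + 1)) * maxPole p ν (i + 1) ≤ maxPole p ν j := by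
      have h1 := pow_mul_maxPole_le p ν (i + 1) (j - (i + 1))
      rw [Nat.add_sub_cancel' hi] at h1
      exact_mod_cast h1
    have h2 : (maxPole p ν (i + 1) : ℤ) ≤ maxPole p ν j := by
      refine le_trans ?_ h1
      refine le_mul_of_one_le_left (by positivity) (one_le_pow₀ (by omega))
    rw [WithTop.coe_lt_coe, Nat.cast_sub (Nat.one_le_pow _ _ hp.out.pos)]
    push_cast
    have e1 : (p : ℤ) ^ n = p ^ (n - 1) * p := by rw [← pow_succ]; congr 1; omega
    have e2 : (p : ℤ) ^ (j - i) = p ^ (j - (i + 1)) * p := by rw [← pow_succ]; congr 1; omega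
    rw [pow_succ, e1, e2]
    have hP : (0 : ℤ) < p ^ (n - 1) := by positivity
    generalize (p : ℤ) ^ (n - 1) = P at *
    generalize (p : ℤ) ^ (j - (i + 1)) = Q at *
    generalize (maxPole p ν (i + 1) : ℤ) = a at *
    generalize (maxPole p ν j : ℤ) = b at *
    have h3 : Q * p * a + (p - 1) * a < p * p * b := by
      have i1 := mul_le_mul_of_nonneg_left h1 (show (0 : ℤ) ≤ p by omega)
      have i2 := mul_le_mul_of_nonneg_left h2 (show (0 : ℤ) ≤ p - 1 by omega)
      have i3 : 0 < ((p : ℤ) - 1) * (p - 1) * b := by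
        have : 0 < (p : ℤ) - 1 := by omega
        positivity
      linarith
    nlinarith
  rw [derivation_carry, V.map_sub_eq_of_lt_left, hmain]
  rwa [hmain]

theorem val_witt_components {t : L} (ht : V t = ((1 : ℤ) : WithTop ℤ)) (hn : 1 ≤ n)
    (hν : ∀ i < n, 0 < ν i ∧ ¬ p ∣ ν i)
    (hU : ∀ i < n, V ((frobenius Y - Y).coeff i) = ((-(p ^ n * ν i) : ℤ) : WithTop ℤ))
    (hθU : ∀ i < n, V (θ ((frobenius Y - Y).coeff i)) = ((-(p ^ n * ν i) : ℤ) : WithTop ℤ)) :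
    ∀ i < n, ((-(p ^ n * maxPole p ν (i + 1)) : ℤ) : WithTop ℤ) ≤ V (Y.coeff i ^ p - Y.coeff i) ∧
      ((-(p ^ (n - 1) * maxPole p ν (i + 1)) : ℤ) : WithTop ℤ) ≤ V (Y.coeff i) ∧
      V (θ (Y.coeff i)) = ((-(p ^ n * maxPole p ν (i + 1)) : ℤ) : WithTop ℤ) := by
  intro j
  induction j using Nat.strong_induction_on with
  | _ j ih =>
    intro hj
    have hr : Y.coeff j ^ p - Y.coeff j =
        (frobenius Y - Y).coeff j - (frobenius (init j Y) - init j Y).coeff j := by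
      rw [frobenius_sub_coeff Y j]
      ring
    have hY := fun i hi => (ih i hi (hi.trans hj)).2.1
    have hθY := fun i hi => (ih i hi (hi.trans hj)).2.2
    have h1 : ((-(p ^ n * maxPole p ν (j + 1)) : ℤ) : WithTop ℤ) ≤
        V (Y.coeff j ^ p - Y.coeff j) := by
      rw [hr, maxPole_succ]
      refine V.map_le_sub ?_ ?_
      · rw [hU j hj, WithTop.coe_le_coe, neg_le_neg_iff]
        exact mul_le_mul_of_nonneg_left (by exact_mod_cast le_max_right _ _) (by positivity)
      · refine le_trans ?_ (le_val_carry ht hj.le hn hY)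
        rw [WithTop.coe_le_coe, neg_le_neg_iff, pow_succ, mul_assoc]
        exact mul_le_mul_of_nonneg_left (by exact_mod_cast le_max_left _ _) (by positivity)
    refine ⟨h1, ?_, ?_⟩
    · refine le_val_of_le_val_artinSchreier (p := p) (by positivity) ?_
      convert h1 using 2
      rw [← mul_assoc, ← pow_succ']
      congr 3
      omega
    · have h2 : θ (Y.coeff j) = -(θ ((frobenius Y - Y).coeff j) -
          θ ((frobenius (init j Y) - init j Y).coeff j)) := by
        rw [← map_sub, ← hr, map_sub, derivation_pow_char]
        ring
      rw [h2, V.map_neg, sub_eq_add_neg]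
      by_cases hj0 : j = 0
      · subst hj0
        have h3 : (frobenius (init 0 Y) - init 0 Y).coeff 0 = 0 := by
          have h4 : init 0 Y = 0 := by
            ext i
            simp [init_coeff]
          rw [h4, map_zero, sub_zero, WittVector.zero_coeff]
        rw [h3, map_zero, neg_zero, add_zero, hθU 0 hj, maxPole_succ, maxPole_zero]
        simp
      · have h3 := val_derivation_carry hj.le (by omega) (fun i hi => hν i (hi.trans hj))
          (fun i hi => hU i (hi.trans hj)) (fun i hi => hθU i (hi.trans hj)) hY hθY
        rw [← V.map_neg] at h3
        rw [val_add_eq_neg_max ?_ (hθU j hj) h3, maxPole_succ, max_comm]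
        · congr 1
          push_cast
          rw [pow_succ, mul_assoc, ← mul_max_of_nonneg _ _ (by positivity)]
        · intro h
          have h0 : (p : ℤ) ^ n ≠ 0 := by
            have := hp.out.ne_zero
            positivity
          have h1 : (ν j : ℤ) = p * maxPole p ν j := by
            apply mul_left_cancel₀ h0
            rw [h]
            ring
          exact (hν j hj).2 ⟨maxPole p ν j, by exact_mod_cast h1⟩

end Bounds

section LaurentSeries

/-- The additive map underlying the derivation `s * d/ds` on Laurent series in `s`. -/
def eulerMap (k : Type*) [CommRing k] : LaurentSeries k →+ LaurentSeries k where
  toFun f :=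
    { coeff := fun n => n * f.coeff n
      isPWO_support' := f.isPWO_support.mono fun n hn h0 => hn (by simp [h0]) }
  map_zero' := by ext; simp
  map_add' f g := by ext; simp [mul_add]

theorem eulerMap_coeff {k : Type*} [CommRing k] (f : LaurentSeries k) (n : ℤ) :
    (eulerMap k f).coeff n = n * f.coeff n := rfl

theorem eulerMap_support_subset {k : Type*} [CommRing k] (f : LaurentSeries k) :
    (eulerMap k f).support ⊆ f.support := fun n hn h0 => hn (by rw [eulerMap_coeff, h0, mul_zero])

theorem eulerMap_mul {k : Type*} [CommRing k] (f g : LaurentSeries k) :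
    eulerMap k (f * g) = f * eulerMap k g + g * eulerMap k f := by
  ext n
  rw [mul_comm g, eulerMap_coeff, HahnSeries.coeff_add,
    HahnSeries.coeff_mul_right' g.isPWO_support (eulerMap_support_subset g),
    HahnSeries.coeff_mul_left' f.isPWO_support (eulerMap_support_subset f),
    HahnSeries.coeff_mul, Finset.mul_sum, ← Finset.sum_add_distrib]
  refine Finset.sum_congr rfl fun ij hij => ?_
  rw [Finset.mem_antidiagonal] at hij
  rw [eulerMap_coeff, eulerMap_coeff, ← hij.2.2]
  push_cast
  ring

/-- The derivation `s * d/ds` on a field identified with the Laurent series field in `s`. -/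
noncomputable def eulerDerivation {k K : Type*} [Field k] [Field K] (ι : K ≃+* LaurentSeries k) :
    Derivation ℤ K K :=
  Derivation.mk' (((ι.symm : LaurentSeries k →+ K).comp
    ((eulerMap k).comp (ι : K →+ LaurentSeries k))).toIntLinearMap) fun x y => by
      simp [eulerMap_mul]

theorem le_order_eulerMap {k : Type*} [CommRing k] {f : LaurentSeries k}
    (hf : eulerMap k f ≠ 0) : f.order ≤ (eulerMap k f).order := by
  rw [HahnSeries.le_order_iff_forall hf]
  intro n hn
  rw [eulerMap_coeff, HahnSeries.coeff_eq_zero_of_lt_order hn, mul_zero]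

theorem order_eulerMap {p : ℕ} {k : Type*} [Field k] [CharP k p] {f : LaurentSeries k}
    (h0 : f ≠ 0) (hf : ¬ (p : ℤ) ∣ f.order) :
    eulerMap k f ≠ 0 ∧ (eulerMap k f).order = f.order := by
  have h : (eulerMap k f).coeff f.order ≠ 0 := by
    rw [eulerMap_coeff]
    refine mul_ne_zero ?_ (HahnSeries.coeff_order_eq_zero.not.mpr h0)
    rwa [Ne, CharP.intCast_eq_zero_iff k p]
  have h1 := HahnSeries.ne_zero_of_coeff_ne_zero h
  exact ⟨h1, le_antisymm (HahnSeries.order_le_of_coeff_ne_zero h) (le_order_eulerMap h1)⟩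

theorem exists_pow_approx_laurentSeries {p : ℕ} [hp : Fact p.Prime] {k : Type*} [Field k]
    [CharP k p] [PerfectField k] (f : LaurentSeries k) {m : ℤ} (hm : f.order = p * m) :
    ∃ g : LaurentSeries k, f - g ^ p ≠ 0 → f.order < (f - g ^ p).order := by
  have : ExpChar k p := ExpChar.prime hp.out
  obtain ⟨b, hb⟩ := (frobeniusEquiv k p).surjective (f.coeff f.order)
  rw [frobeniusEquiv_apply, frobenius_def] at hb
  refine ⟨HahnSeries.single m b, fun h0 => ?_⟩
  rw [← Int.add_one_le_iff, HahnSeries.le_order_iff_forall h0]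
  intro n hn
  have hg : (HahnSeries.single m b : LaurentSeries k) ^ p = HahnSeries.single (p * m) (b ^ p) := by
    rw [HahnSeries.single_pow, nsmul_eq_mul]
  rw [HahnSeries.coeff_sub, hg, ← hm, hb]
  rcases (Int.lt_add_one_iff.mp hn).lt_or_eq with h | h
  · rw [HahnSeries.coeff_eq_zero_of_lt_order h, HahnSeries.coeff_single_of_ne h.ne, sub_zero]
  · rw [h, HahnSeries.coeff_single_same, sub_self]

theorem hasLogDifferent_laurentSeries {p : ℕ} [hp : Fact p.Prime] {k K L : Type*} [Field k]
    [CharP k p] [PerfectField k] [Field K] [Field L] (ι : K ≃+* LaurentSeries k) (f : K →+* L)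
    {V : AddValuation L (WithTop ℤ)} {q : ℤ} (hq : 0 < q)
    (hV : ∀ x : K, x ≠ 0 → V (f x) = ((q * (ι x).order : ℤ) : WithTop ℤ))
    {θ : Derivation ℤ L L} (hθ : ∀ x, θ (f x) = f (ι.symm (eulerMap k (ι x)))) :
    HasLogDifferent V p θ f.fieldRange q 0 := by
  have hE : ∀ g : LaurentSeries k, g ≠ 0 → V (f (ι.symm g)) = ((q * g.order : ℤ) : WithTop ℤ) := by
    intro g hg
    rw [hV _ ((map_ne_zero ι.symm).mpr hg), ι.apply_symm_apply]
  have hm : ∀ x : K, ∀ m : ℤ, V (f x) = ((q * m : ℤ) : WithTop ℤ) → x ≠ 0 ∧ (ι x).order = m := by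
    intro x m h
    have hx : x ≠ 0 := by
      rintro rfl
      rw [map_zero, V.map_zero] at h
      exact WithTop.top_ne_coe h
    rw [hV x hx, WithTop.coe_inj] at h
    exact ⟨hx, mul_left_cancel₀ hq.ne' h⟩
  refine ⟨?_, ?_, ?_, ?_⟩
  · rintro _ ⟨x, rfl⟩ h0
    exact ⟨_, hV x ((map_ne_zero f).mp h0)⟩
  · rintro _ ⟨x, rfl⟩ m h
    obtain ⟨-, rfl⟩ := hm x m h
    rw [hθ, sub_zero]
    by_cases h0 : eulerMap k (ι x) = 0
    · rw [h0, map_zero, map_zero, V.map_zero]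
      exact le_top
    · rw [hE _ h0, WithTop.coe_le_coe]
      exact mul_le_mul_of_nonneg_left (le_order_eulerMap h0) hq.le
  · rintro _ ⟨x, rfl⟩ m hpm h
    obtain ⟨hx, rfl⟩ := hm x m h
    obtain ⟨h0, h1⟩ := order_eulerMap ((map_ne_zero ι).mpr hx) hpm
    rw [hθ, sub_zero, hE _ h0, h1]
  · rintro _ ⟨x, rfl⟩ m h
    obtain ⟨hx, h1⟩ := hm x _ h
    obtain ⟨g, hg⟩ := exists_pow_approx_laurentSeries (ι x) h1
    refine ⟨f (ι.symm g), ⟨_, rfl⟩, ?_⟩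
    have h2 : f x - f (ι.symm g) ^ p = f (ι.symm (ι x - g ^ p)) := by simp
    rw [h2]
    by_cases h0 : ι x - g ^ p = 0
    · rw [h0, map_zero, map_zero, V.map_zero, h]
      exact WithTop.coe_lt_top _
    · rw [hE _ h0, hV x hx, WithTop.coe_lt_coe]
      exact mul_lt_mul_of_pos_left (hg h0) hq

theorem exists_derivation_extension {K L : Type*} [Field K] [Field L] [Algebra K L]
    [Algebra.IsSeparable K L] (D : Derivation ℤ K K) :
    ∃ θ : Derivation ℤ L L, ∀ x : K, θ (algebraMap K L x) = algebraMap K L (D x) := by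
  have := Algebra.FormallyEtale.of_isSeparable K L
  let e := KaehlerDifferential.tensorKaehlerEquivOfFormallyEtale ℤ K L
  let φ : TensorProduct K L (KaehlerDifferential ℤ K) →ₗ[L] L :=
    TensorProduct.AlgebraTensorModule.lift
      ((LinearMap.lsmul L (KaehlerDifferential ℤ K →ₗ[K] L)).flip
        ((Algebra.linearMap K L).comp D.liftKaehlerDifferential))
  refine ⟨(φ.comp e.symm.toLinearMap).compDer (KaehlerDifferential.D ℤ L), fun x => ?_⟩
  have h := KaehlerDifferential.tensorKaehlerEquivOfFormallyEtale_symm_D_algebraMap ℤ K L x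
  change φ (e.symm (KaehlerDifferential.D ℤ L (algebraMap K L x))) = _
  rw [h]
  simp [φ]

end LaurentSeries

section Tower

open WittVector

theorem exists_sum_pow_of_mem_adjoin {p : ℕ} (hp : 1 < p) {K L : Type*} [Field K] [Field L]
    [Algebra K L] {E : IntermediateField K L} {x : L} (hr : x ^ p - x ∈ E) {z : L}
    (hz : z ∈ IntermediateField.adjoin E {x}) :
    ∃ a : ℕ → L, (∀ i, a i ∈ E) ∧ z = ∑ i ∈ Finset.range p, a i * x ^ i := by
  let Q : Polynomial E := Polynomial.X ^ p + (-Polynomial.X - Polynomial.C ⟨_, hr⟩)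
  have hdeg : (-Polynomial.X - Polynomial.C ⟨_, hr⟩ : Polynomial E).degree < (p : WithBot ℕ) := by
    refine lt_of_le_of_lt (Polynomial.degree_sub_le _ _) (max_lt ?_ ?_)
    · rw [Polynomial.degree_neg, Polynomial.degree_X]
      exact_mod_cast hp
    · refine lt_of_le_of_lt Polynomial.degree_C_le ?_
      exact_mod_cast (by omega : 0 < p)
  have hQ : Q.Monic := Polynomial.monic_X_pow_add hdeg
  have hQx : Polynomial.aeval x Q = 0 := by
    simp [Q, IntermediateField.algebraMap_apply]
    ring
  have hQd : Q.natDegree = p := by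
    rw [Polynomial.natDegree_eq_of_degree_eq (Polynomial.degree_add_eq_left_of_degree_lt
      (by rwa [Polynomial.degree_X_pow])), Polynomial.natDegree_X_pow]
  have hmem : IsIntegral E x := ⟨Q, hQ, by simpa [Polynomial.aeval_def] using hQx⟩
  rw [← IntermediateField.mem_toSubalgebra,
    IntermediateField.adjoin_simple_toSubalgebra_of_isAlgebraic hmem.isAlgebraic,
    Algebra.adjoin_singleton_eq_range_aeval] at hz
  obtain ⟨P, rfl⟩ := hz
  refine ⟨fun i => ((P %ₘ Q).coeff i : L), fun i => ((P %ₘ Q).coeff i).2, ?_⟩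
  have h1 : Polynomial.aeval x P = Polynomial.aeval x (P %ₘ Q) := by
    rw [Polynomial.modByMonic_eq_sub_mul_div P, map_sub, map_mul, hQx, zero_mul, sub_zero]
  have h2 : (P %ₘ Q).natDegree < p := by
    rw [← hQd]
    refine Polynomial.natDegree_modByMonic_lt _ hQ fun h => ?_
    rw [h, Polynomial.natDegree_one] at hQd
    omega
  change Polynomial.aeval x P = _
  rw [h1, Polynomial.aeval_eq_sum_range' h2]
  rfl

variable {p : ℕ} [hp : Fact p.Prime]

/-- The intermediate field generated by the components of `Y` of index less than `j`. -/
def towerField (K : Type*) {L : Type*} [Field K] [Field L] [Algebra K L] (Y : WittVector p L)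
    (j : ℕ) : IntermediateField K L :=
  IntermediateField.adjoin K {x | ∃ i < j, Y.coeff i = x}

/-- The depth of ramification `deg 𝔇 - p ^ j + 1` at level `j` of the Artin–Schreier–Witt tower
with pole orders `ν`. -/
def towerDepth (p : ℕ) (ν : ℕ → ℕ) : ℕ → ℤ
  | 0 => 0
  | j + 1 => towerDepth p ν j + (p - 1) * p ^ j * maxPole p ν (j + 1)

theorem towerDepth_bounds {ν : ℕ → ℕ} (hν : 0 < ν 0) (j : ℕ) :
    0 ≤ towerDepth p ν j ∧ (p + 1) * towerDepth p ν j < p ^ j * maxPole p ν (j + 1) := by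
  have hp2 : (2 : ℤ) ≤ p := by exact_mod_cast hp.out.two_le
  induction j with
  | zero =>
    have := maxPole_pos (j := 1) hp.out.pos hν le_rfl
    simpa [towerDepth] using this
  | succ j ih =>
    obtain ⟨h0, h1⟩ := ih
    have h2 : (p : ℤ) * maxPole p ν (j + 1) ≤ maxPole p ν (j + 1 + 1) := by
      rw [maxPole_succ p ν (j + 1)]
      exact_mod_cast le_max_left _ _
    have h3 : (0 : ℤ) ≤ p ^ j * maxPole p ν (j + 1) := by positivity
    rw [towerDepth]
    constructor
    · have : 0 ≤ ((p : ℤ) - 1) * p ^ j * maxPole p ν (j + 1) := by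
        rw [mul_assoc]
        exact mul_nonneg (by omega) h3
      omega
    · have h4 := mul_le_mul_of_nonneg_left h2 (show (0 : ℤ) ≤ p ^ (j + 1) by positivity)
      refine lt_of_lt_of_le ?_ h4
      rw [pow_succ]
      nlinarith

theorem coeff_carry_mem {K L : Type*} [Field K] [Field L] [Algebra K L] [CharP L p]
    (Y : WittVector p L) (j : ℕ) :
    (frobenius (init j Y) - init j Y).coeff j ∈ towerField K Y j := by
  have hY : ∀ i, (init j Y).coeff i ∈ (towerField K Y j).toSubfield.toSubring := by
    intro i
    rw [init_coeff]
    split_ifs with hi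
    · exact IntermediateField.subset_adjoin _ _ ⟨i, hi, rfl⟩
    · exact zero_mem _
  refine coeff_sub_mem (towerField K Y j).toSubfield.toSubring (fun i => ?_) hY j
  rw [coeff_frobenius_charP]
  exact pow_mem (hY i) p

variable {L : Type*} [Field L] {V : AddValuation L (WithTop ℤ)} [CharP L p]
  {n : ℕ} {ν : ℕ → ℕ} {θ : Derivation ℤ L L} {Y : WittVector p L}

theorem hasLogDifferent_towerField {K : Type*} [Field K] [Algebra K L] {t : L}
    (ht : V t = ((1 : ℤ) : WithTop ℤ)) (hn : 1 ≤ n) (hν : ∀ i < n, 0 < ν i ∧ ¬ p ∣ ν i)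
    (hUK : ∀ i < n, ∃ a : K, algebraMap K L a = (frobenius Y - Y).coeff i)
    (hU : ∀ i < n, V ((frobenius Y - Y).coeff i) = ((-(p ^ n * ν i) : ℤ) : WithTop ℤ))
    (hθU : ∀ i < n, V (θ ((frobenius Y - Y).coeff i)) = ((-(p ^ n * ν i) : ℤ) : WithTop ℤ))
    (hK : HasLogDifferent V p θ (algebraMap K L).fieldRange (p ^ n) 0) :
    ∀ j ≤ n, HasLogDifferent V p θ (towerField K Y j).toSubfield (p ^ (n - j))
      (towerDepth p ν j) := by
  have hp2 : (2 : ℤ) ≤ p := by exact_mod_cast hp.out.two_le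
  intro j
  induction j with
  | zero =>
    intro _
    have h0 : (towerField K Y 0).toSubfield = (algebraMap K L).fieldRange := by
      have : {x | ∃ i < 0, Y.coeff i = x} = (∅ : Set L) := by
        ext x
        simp
      rw [towerField, this, IntermediateField.adjoin_empty, IntermediateField.bot_toSubfield]
    rw [h0]
    exact hK
  | succ j ih =>
    intro hj
    have H := ih (by omega)
    obtain ⟨hr, -, hθ⟩ := val_witt_components ht hn hν hU hθU j hj
    obtain ⟨hμ0, hμ⟩ := towerDepth_bounds (p := p) (hν 0 (by omega)).1 j
    have hq : (0 : ℤ) < p ^ (n - j) := by positivity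
    have hpn : (p : ℤ) ^ n = p ^ (n - j) * p ^ j := by
      rw [← pow_add]
      congr 1
      omega
    have hrE : Y.coeff j ^ p - Y.coeff j ∈ (towerField K Y j).toSubfield := by
      have h1 : Y.coeff j ^ p - Y.coeff j =
          (frobenius Y - Y).coeff j - (frobenius (init j Y) - init j Y).coeff j := by
        rw [frobenius_sub_coeff Y j]
        ring
      rw [h1]
      obtain ⟨a, ha⟩ := hUK j hj
      rw [← ha]
      exact sub_mem ((towerField K Y j).algebraMap_mem a) (coeff_carry_mem Y j)
    have hN : 0 < p ^ j * (maxPole p ν (j + 1) : ℤ) - towerDepth p ν j := by nlinarith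
    obtain ⟨h, hh, hVh, hpN⟩ := H.exists_reduced hq hN hrE
      (by
        rw [map_sub, derivation_pow_char, zero_sub, V.map_neg, hθ, hpn]
        congr 1
        ring)
      (lt_of_lt_of_le (by
        rw [WithTop.coe_lt_coe, hpn, mul_assoc, ← mul_neg, ← mul_neg]
        refine mul_lt_mul_of_pos_left ?_ hq
        nlinarith) hr)
    have hx : (Y.coeff j - h) ^ p - (Y.coeff j - h) =
        Y.coeff j ^ p - Y.coeff j - (h ^ p - h) := by
      rw [sub_pow_char]
      ring
    have hle : towerField K Y j ≤ towerField K Y (j + 1) :=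
      IntermediateField.adjoin.mono _ _ _ fun x ⟨i, hi, hix⟩ => ⟨i, by omega, hix⟩
    have hpq : (p : ℤ) ^ (n - j) = p * p ^ (n - (j + 1)) := by
      rw [← pow_succ']
      congr 1
      omega
    rw [hpq] at H hVh
    have hrx : (Y.coeff j - h) ^ p - (Y.coeff j - h) ∈ (towerField K Y j).toSubfield := by
      rw [hx]
      exact sub_mem hrE (sub_mem (pow_mem hh p) hh)
    have key := H.extend (F' := (towerField K Y (j + 1)).toSubfield) (x := Y.coeff j - h)
      (by positivity) hN hpN
      (sub_mem (IntermediateField.subset_adjoin _ _ ⟨j, by omega, rfl⟩) (hle hh)) hrx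
      (by rw [hx, hVh]) hle fun z hz => by
        refine exists_sum_pow_of_mem_adjoin hp.out.one_lt hrx ?_
        have h2 : towerField K Y (j + 1) ≤ (IntermediateField.adjoin (towerField K Y j)
            {Y.coeff j - h}).restrictScalars K := by
          refine IntermediateField.adjoin_le_iff.mpr ?_
          have hEm : ∀ x ∈ towerField K Y j, x ∈ IntermediateField.adjoin (towerField K Y j)
              {Y.coeff j - h} := fun x hx => IntermediateField.algebraMap_mem _ (⟨x, hx⟩ :
                towerField K Y j)
          rintro x ⟨i, hi, rfl⟩
          rcases Nat.lt_succ_iff_lt_or_eq.mp hi with hij | rfl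
          · exact hEm _ (IntermediateField.subset_adjoin _ _ ⟨i, hij, rfl⟩)
          · have h3 := add_mem (IntermediateField.mem_adjoin_simple_self (towerField K Y i)
              (Y.coeff i - h)) (hEm h hh)
            rwa [sub_add_cancel] at h3
        exact h2 hz
    convert key using 1
    rw [towerDepth]
    ring

end Tower

section Different

open KaehlerDifferential

theorem annihilator_kaehlerDifferential_le {A B : Type*} [CommRing A] [CommRing B] [Algebra A B]
    (δ : B →+ B) (hδ : ∀ x y, δ (x * y) = x * δ y + y * δ x) (I : Ideal B)
    (hA : ∀ a : A, δ (algebraMap A B a) ∈ I) {t : B} (ht : δ t = 1) :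
    Module.annihilator B Ω[B⁄A] ≤ I := by
  let φ : B →ₗ[A] B ⧸ I :=
    { toFun := fun x => Ideal.Quotient.mk I (δ x)
      map_add' := fun x y => by simp
      map_smul' := fun a x => by
        have h : Ideal.Quotient.mk I (δ (algebraMap A B a)) = 0 :=
          Ideal.Quotient.eq_zero_iff_mem.mpr (hA a)
        rw [Algebra.smul_def, hδ, map_add, map_mul, map_mul, h, mul_zero, add_zero,
          RingHom.id_apply, Algebra.smul_def]
        rfl }
  let D : Derivation A B (B ⧸ I) := Derivation.mk' φ fun x y => by
    simp only [φ, LinearMap.coe_mk, AddHom.coe_mk]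
    rw [hδ, map_add, map_mul, map_mul, Algebra.smul_def, Algebra.smul_def]
    rfl
  intro b hb
  rw [Module.mem_annihilator] at hb
  have h := congrArg D.liftKaehlerDifferential (hb (KaehlerDifferential.D A B t))
  rw [map_smul, Derivation.liftKaehlerDifferential_comp_D, map_zero] at h
  have hDt : D t = 1 := by
    change Ideal.Quotient.mk I (δ t) = 1
    rw [ht, map_one]
  rw [hDt, Algebra.smul_def, mul_one] at h
  exact Ideal.Quotient.eq_zero_iff_mem.mp h

theorem aeval_derivative_mem_annihilator {A B : Type*} [CommRing A] [CommRing B] [Algebra A B]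
    {t : B} (hgen : ∀ x : B, ∃ P : Polynomial A, Polynomial.aeval t P = x) {P : Polynomial A}
    (hP : Polynomial.aeval t P = 0) :
    Polynomial.aeval t P.derivative ∈ Module.annihilator B Ω[B⁄A] := by
  have ht : Polynomial.aeval t P.derivative • KaehlerDifferential.D A B t = 0 := by
    rw [← Derivation.map_aeval, hP, map_zero]
  rw [Module.mem_annihilator]
  intro ω
  have hω : ω ∈ Submodule.span B (Set.range (KaehlerDifferential.D A B)) := by
    rw [KaehlerDifferential.span_range_derivation]
    exact Submodule.mem_top
  induction hω using Submodule.span_induction with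
  | mem ω h =>
    obtain ⟨x, rfl⟩ := h
    obtain ⟨R, rfl⟩ := hgen x
    rw [Derivation.map_aeval, smul_comm, ht, smul_zero]
  | zero => rw [smul_zero]
  | add x y _ _ hx hy => rw [smul_add, hx, hy, add_zero]
  | smul b x _ hx => rw [smul_comm, hx, smul_zero]

variable {L : Type*} [Field L] {V : AddValuation L (WithTop ℤ)} {p : ℕ} [CharP L p]
  {θ : Derivation ℤ L L}

theorem HasLogDifferent.le_val_of_nonneg {F : Subfield L} {q μ : ℤ}
    (H : HasLogDifferent V p θ F q μ) (hq : 0 < q) {x : L} (hx : x ∈ F) (h0 : 0 ≤ V x) :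
    ((q * (1 - μ) : ℤ) : WithTop ℤ) ≤ V (θ x) := by
  have hpos : ∀ y ∈ F, 0 < V y → ((q * (1 - μ) : ℤ) : WithTop ℤ) ≤ V (θ y) := by
    intro y hy h
    by_cases hy0 : y = 0
    · rw [hy0, map_zero, V.map_zero]
      exact le_top
    · obtain ⟨m, hm⟩ := H.dvd y hy hy0
      refine le_trans ?_ (H.le y hy m hm)
      rw [hm, ← WithTop.coe_zero, WithTop.coe_lt_coe] at h
      rw [WithTop.coe_le_coe]
      have := pos_of_mul_pos_right h hq.le
      exact mul_le_mul_of_nonneg_left (by omega) hq.le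
  rcases h0.lt_or_eq with h | h
  · exact hpos x hx h
  · obtain ⟨g, hg, hlt⟩ := H.approx x hx 0 (by rw [← h]; simp)
    have h1 := hpos (x - g ^ p) (sub_mem hx (pow_mem hg p)) (by rwa [← h] at hlt)
    rwa [map_sub, derivation_pow_char, sub_zero] at h1

variable {K : Type*} [Field K] [Algebra K L] {Q : ℕ} {t : L}

theorem smul_pow_eq_zero_of_val_eq
    (hK : ∀ x : K, x ≠ 0 → ∃ m : ℤ, V (algebraMap K L x) = ((Q * m : ℤ) : WithTop ℤ))
    (ht : V t = ((1 : ℤ) : WithTop ℤ)) (c : ℕ → K) {i j : ℕ} (hi : i < Q) (hj : j < Q)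
    (hij : i ≠ j) (h : V (c i • t ^ i) = V (c j • t ^ j)) : c i • t ^ i = 0 := by
  by_contra h0
  have hi0 : c i ≠ 0 := fun h => h0 (by rw [h, zero_smul])
  have hj0 : c j ≠ 0 := by
    intro hj0
    rw [hj0, zero_smul, V.map_zero, V.top_iff] at h
    exact h0 h
  obtain ⟨a, ha⟩ := hK _ hi0
  obtain ⟨b, hb⟩ := hK _ hj0
  rw [Algebra.smul_def, Algebra.smul_def, val_mul_eq V ha (val_pow_eq V ht i),
    val_mul_eq V hb (val_pow_eq V ht j), WithTop.coe_inj] at h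
  have h1 : (Q : ℤ) ∣ (i : ℤ) - j := ⟨b - a, by linear_combination h⟩
  have h2 := Int.eq_zero_of_abs_lt_dvd h1 (by rw [abs_lt]; omega)
  omega

theorem exists_sum_smul_pow
    (hK : ∀ x : K, x ≠ 0 → ∃ m : ℤ, V (algebraMap K L x) = ((Q * m : ℤ) : WithTop ℤ))
    (ht : V t = ((1 : ℤ) : WithTop ℤ)) (hQ : 0 < Q) (hrank : Module.finrank K L = Q) (z : L) :
    ∃ c : ℕ → K, z = ∑ i ∈ Finset.range Q, c i • t ^ i := by
  have hli : LinearIndependent K fun i : Fin Q => t ^ (i : ℕ) := by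
    rw [Fintype.linearIndependent_iff]
    intro g hg i
    let c : ℕ → K := fun j => if h : j < Q then g ⟨j, h⟩ else 0
    have hc : ∀ j : Fin Q, c j = g j := fun j => by simp [c]
    have hsum : ∑ j ∈ Finset.range Q, c j • t ^ j = 0 := by
      rw [← hg, Finset.sum_range]
      exact Finset.sum_congr rfl fun j _ => by rw [hc]
    have h1 := le_val_terms_of_le_val_sum V (Finset.range Q) (fun j => c j • t ^ j)
      (fun j hj l hl hjl h => smul_pow_eq_zero_of_val_eq hK ht c (Finset.mem_range.mp hj)
        (Finset.mem_range.mp hl) hjl h) (m := ⊤) (by rw [hsum, V.map_zero]) i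
        (Finset.mem_range.mpr i.2)
    rw [top_le_iff, V.top_iff, hc, smul_eq_zero] at h1
    exact h1.resolve_right (pow_ne_zero _ (ne_zero_of_val_eq V ht))
  have : Nonempty (Fin Q) := ⟨⟨0, hQ⟩⟩
  let b := basisOfLinearIndependentOfCardEqFinrank hli (by rw [Fintype.card_fin, hrank])
  refine ⟨fun j => if h : j < Q then b.repr z ⟨j, h⟩ else 0, ?_⟩
  conv_lhs => rw [← b.sum_repr z]
  rw [Finset.sum_range]
  exact Finset.sum_congr rfl fun j _ => by simp [b]

theorem val_derivative_of_minpoly_relation [hp : Fact p.Prime] {μ : ℤ} {n : ℕ} (hn : 1 ≤ n)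
    (HK : HasLogDifferent V p θ (algebraMap K L).fieldRange (p ^ n) 0)
    (ht : V t = ((1 : ℤ) : WithTop ℤ)) (hθt : V (θ t) = ((1 - μ : ℤ) : WithTop ℤ)) {c : ℕ → K}
    (hc : t ^ p ^ n = ∑ i ∈ Finset.range (p ^ n), c i • t ^ i) :
    V (∑ i ∈ Finset.range (p ^ n), c i • ((i : L) * t ^ (i - 1))) =
      ((p ^ n - 1 + μ : ℤ) : WithTop ℤ) := by
  have hp2 : (2 : ℤ) ≤ p := by exact_mod_cast hp.out.two_le
  have hpn : (0 : ℤ) < p ^ n := by positivity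
  have hK : ∀ x : K, x ≠ 0 →
      ∃ m : ℤ, V (algebraMap K L x) = (((p ^ n : ℕ) * m : ℤ) : WithTop ℤ) := by
    intro x hx
    obtain ⟨m, hm⟩ := HK.dvd _ ⟨x, rfl⟩ ((map_ne_zero _).mpr hx)
    exact ⟨m, by simpa using hm⟩
  have hterm : ∀ i, c i ≠ 0 → ∃ m : ℤ, V (algebraMap K L (c i)) = ((p ^ n * m : ℤ) : WithTop ℤ) ∧
      V (c i • t ^ i) = ((p ^ n * m + i : ℤ) : WithTop ℤ) := by
    intro i hi
    obtain ⟨m, hm⟩ := HK.dvd _ ⟨c i, rfl⟩ ((map_ne_zero _).mpr hi)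
    refine ⟨m, hm, ?_⟩
    rw [Algebra.smul_def, val_mul_eq V hm (val_pow_eq V ht i), mul_one]
  have hVt := val_pow_eq V ht (p ^ n)
  obtain ⟨i, hi, hi0, hV, -, hlt⟩ := exists_dominant_term V (Finset.range (p ^ n))
    (fun i => c i • t ^ i) (fun j hj l hl hjl h => smul_pow_eq_zero_of_val_eq hK ht c
      (Finset.mem_range.mp hj) (Finset.mem_range.mp hl) hjl h)
    (by rw [← hc]; exact ne_zero_of_val_eq V hVt)
  rw [← hc, hVt] at hV
  have hci : c i ≠ 0 := fun h => hi0 (by rw [h, zero_smul])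
  obtain ⟨m, hm, hm'⟩ := hterm i hci
  have hi' : (i : ℤ) < p ^ n := by exact_mod_cast Finset.mem_range.mp hi
  have hm1 : i = 0 ∧ m = 1 := by
    rw [hm', WithTop.coe_inj] at hV
    push_cast at hV
    have h1 : (p : ℤ) ^ n ∣ i := ⟨1 - m, by linear_combination -hV⟩
    have h2 := Int.eq_zero_of_abs_lt_dvd h1 (by rw [abs_lt]; omega)
    refine ⟨by omega, ?_⟩
    apply mul_left_cancel₀ hpn.ne'
    linear_combination -hV - h2
  obtain ⟨rfl, rfl⟩ := hm1
  have hθ : θ (t ^ p ^ n) = 0 := by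
    rw [show p ^ n = p ^ (n - 1) * p by rw [← pow_succ]; congr 1; omega, pow_mul,
      derivation_pow_char]
  have hsplit : (∑ i ∈ Finset.range (p ^ n), c i • ((i : L) * t ^ (i - 1))) * θ t =
      -∑ i ∈ Finset.range (p ^ n), θ (algebraMap K L (c i)) * t ^ i := by
    rw [hc, map_sum] at hθ
    rw [Finset.sum_mul, eq_neg_iff_add_eq_zero, ← Finset.sum_add_distrib, ← hθ]
    refine Finset.sum_congr rfl fun j _ => ?_
    rw [Algebra.smul_def, Algebra.smul_def, Derivation.leibniz, Derivation.leibniz_pow]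
    simp only [smul_eq_mul, nsmul_eq_mul]
    ring
  have hVs : V (∑ i ∈ Finset.range (p ^ n), θ (algebraMap K L (c i)) * t ^ i) =
      ((p ^ n : ℤ) : WithTop ℤ) := by
    have h0 : V (θ (algebraMap K L (c 0)) * t ^ 0) = ((p ^ n : ℤ) : WithTop ℤ) := by
      rw [pow_zero, mul_one, HK.eq _ ⟨_, rfl⟩ 1 (fun h => ?_) hm]
      · simp
      · have := Int.le_of_dvd one_pos h
        omega
    rw [← Finset.add_sum_erase _ _ hi, V.map_add_eq_of_lt_left, h0]
    rw [h0]
    refine V.map_lt_sum WithTop.coe_ne_top fun j hj => ?_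
    have hj0 := Finset.ne_of_mem_erase hj
    by_cases hcj : c j = 0
    · rw [hcj, map_zero, map_zero, zero_mul, V.map_zero]
      exact WithTop.coe_lt_top _
    · obtain ⟨l, hl, hl'⟩ := hterm j hcj
      have h1 := hlt j (Finset.mem_of_mem_erase hj) hj0
      rw [hm', hl', WithTop.coe_lt_coe] at h1
      refine lt_of_lt_of_le ?_ (le_val_mul V (HK.le _ ⟨_, rfl⟩ l hl) (val_pow_eq V ht j).ge)
      rw [WithTop.coe_lt_coe]
      push_cast at h1
      linarith
  rw [← V.map_neg, ← hsplit] at hVs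
  have h1 : ∑ i ∈ Finset.range (p ^ n), c i • ((i : L) * t ^ (i - 1)) =
      (∑ i ∈ Finset.range (p ^ n), c i • ((i : L) * t ^ (i - 1))) * θ t / θ t := by
    rw [mul_div_cancel_right₀ _ (ne_zero_of_val_eq V hθt)]
  rw [h1, val_div_eq V hVs hθt]
  congr 1
  ring

end Different

section DifferentExponent

variable {K L : Type*} [Field K] [Field L] [Algebra K L] {V : AddValuation L (WithTop ℤ)} {p : ℕ}
  [hp : Fact p.Prime] [CharP L p] {θ : Derivation ℤ L L} {n : ℕ} {μ : ℤ} {OL OK : Subring L}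

theorem mem_span_pow_iff_le_val {L : Type*} [Field L] {V : AddValuation L (WithTop ℤ)}
    {OL : Subring L} (hOL : ∀ z, z ∈ OL ↔ 0 ≤ V z) {t : OL}
    (ht : V (t : L) = ((1 : ℤ) : WithTop ℤ)) (e : ℕ) (x : OL) :
    x ∈ Ideal.span {t} ^ e ↔ ((e : ℤ) : WithTop ℤ) ≤ V (x : L) := by
  have hte : V ((t : L) ^ e) = ((e : ℤ) : WithTop ℤ) := by
    rw [val_pow_eq V ht, mul_one]
  rw [Ideal.span_singleton_pow, Ideal.mem_span_singleton]
  constructor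
  · rintro ⟨c, rfl⟩
    have h := le_val_mul V hte.ge ((hOL _).mp c.2)
    simpa using h
  · intro h
    refine ⟨⟨x / t ^ e, (hOL _).mpr ?_⟩, ?_⟩
    · simpa using le_val_div V h hte
    · ext
      simp [mul_div_cancel₀ _ (ne_zero_of_val_eq V hte)]

theorem le_different_exponent (hμ : 0 ≤ μ) (H : HasLogDifferent V p θ ⊤ 1 μ)
    (HK : HasLogDifferent V p θ (algebraMap K L).fieldRange (p ^ n) 0)
    (hOL : ∀ z, z ∈ OL ↔ 0 ≤ V z)
    (hOK : ∀ z, z ∈ OK ↔ z ∈ (algebraMap K L).fieldRange ∧ 0 ≤ V z) (hle : OK ≤ OL) {t : OL}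
    (ht : V (t : L) = ((1 : ℤ) : WithTop ℤ)) {d : ℕ}
    (hd : letI := (Subring.inclusion hle).toAlgebra
      Module.annihilator OL (KaehlerDifferential OK OL) = Ideal.span {t} ^ d) :
    μ + p ^ n - 1 ≤ d := by
  let _ := (Subring.inclusion hle).toAlgebra
  have hpn : (1 : ℤ) ≤ p ^ n := by exact_mod_cast Nat.one_le_pow _ _ hp.out.pos
  have hp2 : (2 : ℤ) ≤ p := by exact_mod_cast hp.out.two_le
  obtain ⟨e, he⟩ : ∃ e : ℕ, μ + p ^ n - 1 = e := Int.eq_ofNat_of_zero_le (by omega)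
  have hθt : V (θ t) = ((1 - μ : ℤ) : WithTop ℤ) := by
    rw [H.eq t trivial 1 (fun h => by have := Int.le_of_dvd one_pos h; omega) (by simpa using ht),
      one_mul]
  have hθ0 := ne_zero_of_val_eq V hθt
  let δ : OL →+ OL :=
    { toFun := fun x => ⟨θ x / θ t, (hOL _).mpr (by
        have h := le_val_div V (H.le_val_of_nonneg one_pos trivial ((hOL _).mp x.2)) hθt
        simpa using h)⟩
      map_zero' := by ext; simp
      map_add' := fun x y => by ext; simp [add_div] }
  have hδ : ∀ x, (δ x : L) = θ x / θ t := fun x => rfl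
  have h := annihilator_kaehlerDifferential_le (A := OK) δ (fun x y => by
    ext
    push_cast
    rw [hδ, hδ, hδ, Subring.coe_mul, Derivation.leibniz]
    simp only [smul_eq_mul]
    ring) (Ideal.span {t} ^ e) (fun a => by
      rw [mem_span_pow_iff_le_val hOL ht, hδ]
      obtain ⟨h1, h2⟩ := (hOK _).mp a.2
      have h3 := le_val_div V (HK.le_val_of_nonneg (by omega) h1 h2) hθt
      have h4 : (e : ℤ) = p ^ n * (1 - 0) - (1 - μ) := by linear_combination -he
      rw [h4]
      exact h3) (t := t) (by
        ext
        rw [hδ, div_self hθ0]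
        rfl)
  rw [hd] at h
  have h1 := (mem_span_pow_iff_le_val hOL ht e (t ^ d)).mp
    (h (Ideal.pow_mem_pow (Ideal.mem_span_singleton_self t) d))
  rw [Subring.coe_pow, val_pow_eq V ht, WithTop.coe_le_coe, mul_one] at h1
  rw [he]
  exact h1

theorem different_exponent_le (hn : 1 ≤ n) (H : HasLogDifferent V p θ ⊤ 1 μ)
    (HK : HasLogDifferent V p θ (algebraMap K L).fieldRange (p ^ n) 0)
    (hrank : Module.finrank K L = p ^ n) (hOL : ∀ z, z ∈ OL ↔ 0 ≤ V z)
    (hOK : ∀ z, z ∈ OK ↔ z ∈ (algebraMap K L).fieldRange ∧ 0 ≤ V z) (hle : OK ≤ OL) {t : OL}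
    (ht : V (t : L) = ((1 : ℤ) : WithTop ℤ)) {d : ℕ}
    (hd : letI := (Subring.inclusion hle).toAlgebra
      Module.annihilator OL (KaehlerDifferential OK OL) = Ideal.span {t} ^ d) :
    d ≤ μ + p ^ n - 1 := by
  let _ := (Subring.inclusion hle).toAlgebra
  have hal : ∀ a : OK, ((algebraMap OK OL a : OL) : L) = a := fun a => rfl
  have hpos : 0 < p ^ n := pow_pos hp.out.pos n
  have hp2 : (2 : ℤ) ≤ p := by exact_mod_cast hp.out.two_le
  have hpn : (0 : ℤ) < p ^ n := by exact_mod_cast hpos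
  have hθt : V (θ t) = ((1 - μ : ℤ) : WithTop ℤ) := by
    rw [H.eq t trivial 1 (fun h => by have := Int.le_of_dvd one_pos h; omega) (by simpa using ht),
      one_mul]
  have hK : ∀ x : K, x ≠ 0 →
      ∃ m : ℤ, V (algebraMap K L x) = (((p ^ n : ℕ) * m : ℤ) : WithTop ℤ) := by
    intro x hx
    obtain ⟨m, hm⟩ := HK.dvd _ ⟨x, rfl⟩ ((map_ne_zero _).mpr hx)
    exact ⟨m, by simpa using hm⟩
  have hcoef : ∀ z : L, 0 ≤ V z → ∃ c : ℕ → K, ∃ a : ℕ → OK,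
      (∀ i < p ^ n, algebraMap K L (c i) = a i) ∧
      z = ∑ i ∈ Finset.range (p ^ n), c i • (t : L) ^ i := by
    intro z hz
    obtain ⟨c, hc⟩ := exists_sum_smul_pow hK ht hpos hrank z
    have hmem : ∀ i < p ^ n, algebraMap K L (c i) ∈ OK := by
      intro i hi
      refine (hOK _).mpr ⟨⟨_, rfl⟩, ?_⟩
      by_cases h0 : c i = 0
      · rw [h0, map_zero, V.map_zero]
        exact le_top
      · obtain ⟨m, hm⟩ := hK _ h0
        have h1 := le_val_terms_of_le_val_sum V (Finset.range (p ^ n)) (fun i => c i • (t : L) ^ i)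
          (fun j hj l hl hjl h => smul_pow_eq_zero_of_val_eq hK ht c (Finset.mem_range.mp hj)
            (Finset.mem_range.mp hl) hjl h) (m := 0) (by rwa [← hc]) i (Finset.mem_range.mpr hi)
        rw [Algebra.smul_def, val_mul_eq V hm (val_pow_eq V ht i), ← WithTop.coe_zero,
          WithTop.coe_le_coe] at h1
        rw [hm, ← WithTop.coe_zero, WithTop.coe_le_coe]
        have hi' : (i : ℤ) < (p ^ n : ℕ) := by exact_mod_cast hi
        have h2 : 0 ≤ m := by
          by_contra hneg
          push Not at hneg
          nlinarith
        positivity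
    classical
    refine ⟨c, fun i => if h : i < p ^ n then ⟨_, hmem i h⟩ else 0, fun i hi => ?_, hc⟩
    simp [hi]
  have haeval : ∀ a : ℕ → OK, ∀ c : ℕ → K,
      (∀ i < p ^ n, algebraMap K L (c i) = a i) →
      ((Polynomial.aeval t (∑ i ∈ Finset.range (p ^ n),
        Polynomial.C (a i) * Polynomial.X ^ i) : OL) : L) =
        ∑ i ∈ Finset.range (p ^ n), c i • (t : L) ^ i := by
    intro a c hac
    rw [map_sum, AddSubmonoidClass.coe_finsetSum]
    refine Finset.sum_congr rfl fun i hi => ?_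
    rw [map_mul, Polynomial.aeval_C, map_pow, Polynomial.aeval_X, Subring.coe_mul, hal,
      Subring.coe_pow, Algebra.smul_def, hac i (Finset.mem_range.mp hi)]
  have hgen : ∀ x : OL, ∃ P : Polynomial OK, Polynomial.aeval t P = x := by
    intro x
    obtain ⟨c, a, hac, hx⟩ := hcoef x ((hOL _).mp x.2)
    exact ⟨_, Subtype.ext ((haeval a c hac).trans hx.symm)⟩
  obtain ⟨c, a, hac, hc⟩ := hcoef ((t : L) ^ p ^ n) ((hOL _).mp (t ^ p ^ n).2)
  have hP : Polynomial.aeval t ((∑ i ∈ Finset.range (p ^ n),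
      Polynomial.C (a i) * Polynomial.X ^ i) - Polynomial.X ^ p ^ n) = 0 := by
    ext
    rw [map_sub, AddSubgroupClass.coe_sub, haeval a c hac, ← hc]
    simp
  have h := aeval_derivative_mem_annihilator hgen hP
  rw [hd, mem_span_pow_iff_le_val hOL ht] at h
  have hcast : ((p ^ n : ℕ) : L) = 0 := by
    rw [Nat.cast_pow, CharP.cast_eq_zero, zero_pow (by omega)]
  have hder : ((Polynomial.aeval t (Polynomial.derivative ((∑ i ∈ Finset.range (p ^ n),
      Polynomial.C (a i) * Polynomial.X ^ i) - Polynomial.X ^ p ^ n)) : OL) : L) =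
      ∑ i ∈ Finset.range (p ^ n), c i • ((i : L) * (t : L) ^ (i - 1)) := by
    rw [Polynomial.derivative_sub, Polynomial.derivative_X_pow, map_sub, map_mul,
      Polynomial.aeval_C, AddSubgroupClass.coe_sub, Subring.coe_mul, hal, Subring.coe_natCast,
      hcast, zero_mul, sub_zero, Polynomial.derivative_sum, map_sum, AddSubmonoidClass.coe_finsetSum]
    refine Finset.sum_congr rfl fun i hi => ?_
    rw [Polynomial.derivative_C_mul_X_pow, map_mul, Polynomial.aeval_C, map_pow,
      Polynomial.aeval_X, Subring.coe_mul, hal, Subring.coe_mul, Subring.coe_natCast,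
      Subring.coe_pow, ← hac i (Finset.mem_range.mp hi), Algebra.smul_def]
    ring
  rw [hder, val_derivative_of_minpoly_relation hn HK ht hθt hc, WithTop.coe_le_coe] at h
  linarith

end DifferentExponent

section CarryReduction

open WittVector

theorem towerDepth_lt {p : ℕ} [hp : Fact p.Prime] {ν : ℕ → ℕ} (hν : 0 < ν 0) {n : ℕ}
    (hn : 1 ≤ n) : (p + 1) * towerDepth p ν n < p ^ (n + 1) * maxPole p ν n := by
  have hp2 : (2 : ℤ) ≤ p := by exact_mod_cast hp.out.two_le
  obtain ⟨j, rfl⟩ := Nat.exists_eq_add_of_le' hn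
  have h := (towerDepth_bounds (p := p) hν j).2
  rw [towerDepth, pow_succ, pow_succ]
  nlinarith

theorem exists_reduced_carry {p : ℕ} [hp : Fact p.Prime] {k K L : Type*} [Field k] [CharP k p]
    [PerfectField k] [Field K] [Field L] [Algebra K L] [Algebra.IsSeparable K L] [CharP L p]
    (ι : K ≃+* LaurentSeries k) {V : AddValuation L (WithTop ℤ)} {Y : WittVector p L} {n : ℕ}
    (hn : 1 ≤ n) {ν : ℕ → ℕ} (hν : ∀ i < n, 0 < ν i ∧ ¬ p ∣ ν i)
    (hV : ∀ x : K, x ≠ 0 → V (algebraMap K L x) = ((p ^ n * (ι x).order : ℤ) : WithTop ℤ))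
    (hU : ∀ i < n, ∃ a : K, a ≠ 0 ∧ (ι a).order = -(ν i : ℤ) ∧
      algebraMap K L a = (frobenius Y - Y).coeff i)
    (htop : towerField K Y n = ⊤) (hrank : Module.finrank K L = p ^ n) {OL OK : Subring L}
    (hOL : ∀ z, z ∈ OL ↔ 0 ≤ V z)
    (hOK : ∀ z, z ∈ OK ↔ z ∈ (algebraMap K L).fieldRange ∧ 0 ≤ V z) (hle : OK ≤ OL) {t : OL}
    (ht : V (t : L) = ((1 : ℤ) : WithTop ℤ)) {d : ℕ}
    (hd : letI := (Subring.inclusion hle).toAlgebra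
      Module.annihilator OL (KaehlerDifferential OK OL) = Ideal.span {t} ^ d) :
    ∃ h : L, V ((frobenius (init n Y) - init n Y).coeff n - (h ^ p - h)) =
      ((-(p ^ (n + 1) * maxPole p ν n - (d - p ^ n + 1)) : ℤ) : WithTop ℤ) := by
  have hp2 : (2 : ℤ) ≤ p := by exact_mod_cast hp.out.two_le
  have hpn : (0 : ℤ) < p ^ n := by positivity
  obtain ⟨θ, hθ⟩ := exists_derivation_extension (L := L) (eulerDerivation ι)
  have HK : HasLogDifferent V p θ (algebraMap K L).fieldRange (p ^ n) 0 :=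
    hasLogDifferent_laurentSeries ι _ hpn hV hθ
  have hVU : ∀ i < n, V ((frobenius Y - Y).coeff i) = ((-(p ^ n * ν i) : ℤ) : WithTop ℤ) := by
    intro i hi
    obtain ⟨a, ha0, ha, haU⟩ := hU i hi
    rw [← haU, hV a ha0, ha, mul_neg]
  have hθU : ∀ i < n,
      V (θ ((frobenius Y - Y).coeff i)) = ((-(p ^ n * ν i) : ℤ) : WithTop ℤ) := by
    intro i hi
    obtain ⟨a, ha0, ha, haU⟩ := hU i hi
    rw [← haU, HK.eq _ ⟨a, rfl⟩ (-(ν i : ℤ)) ?_ (by rw [hV a ha0, ha]), sub_zero, mul_neg]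
    rw [dvd_neg, Int.natCast_dvd_natCast]
    exact (hν i hi).2
  have H : HasLogDifferent V p θ ⊤ 1 (towerDepth p ν n) := by
    have h := hasLogDifferent_towerField ht hn hν
      (fun i hi => (hU i hi).imp fun a ha => ha.2.2) hVU hθU HK n le_rfl
    rwa [htop, Nat.sub_self, pow_zero, IntermediateField.top_toSubfield] at h
  have hν0 := (hν 0 (by omega)).1
  have hμ0 := (towerDepth_bounds (p := p) hν0 n).1
  have hμ := towerDepth_lt (p := p) hν0 hn
  have hdμ : (d : ℤ) - p ^ n + 1 = towerDepth p ν n := by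
    have h1 := le_different_exponent hμ0 H HK hOL hOK hle ht hd
    have h2 := different_exponent_le hn H HK hrank hOL hOK hle ht hd
    omega
  have hcomp := val_witt_components ht hn hν hVU hθU
  obtain ⟨h, -, hVh, -⟩ := H.exists_reduced (z := (frobenius (init n Y) - init n Y).coeff n)
    (N := p ^ (n + 1) * maxPole p ν n - towerDepth p ν n) one_pos (by nlinarith) trivial
    (by
      rw [val_derivation_carry le_rfl hn hν hVU hθU (fun i hi => (hcomp i hi).2.1)
        fun i hi => (hcomp i hi).2.2]
      congr 1
      ring)
    (lt_of_lt_of_le (by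
      rw [WithTop.coe_lt_coe]
      have h1 := mul_le_mul_of_nonneg_right hp2 hμ0
      have h2 := mul_le_mul_of_nonneg_right hp2
        (show 0 ≤ p ^ (n + 1) * (maxPole p ν n : ℤ) - towerDepth p ν n by nlinarith)
      linarith) (le_val_carry ht le_rfl hn fun i hi => (hcomp i hi).2.1))
  refine ⟨h, ?_⟩
  rw [hVh, hdμ, one_mul]

theorem truncate_frobenius_sub {p : ℕ} [Fact p.Prime] {R : Type*} [CommRing R] [CharP R p] {m : ℕ}
    (y : TruncatedWittVector p m R) (i : Fin m) :
    (frobenius y.out - y.out).coeff i = (twFrobenius p m y - y).coeff i := by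
  have h : twFrobenius p m y = truncateFun m (frobenius y.out) := by
    ext j
    rw [coeff_truncateFun, coeff_frobenius_charP, TruncatedWittVector.coeff_out]
    simp [twFrobenius]
  rw [h, ← coeff_truncateFun, truncateFun_sub, TruncatedWittVector.truncateFun_out]

theorem exists_witt_lift {p : ℕ} [Fact p.Prime] {K Ω : Type*} [Field K] [Field Ω] [Algebra K Ω]
    [CharP Ω p] (E : IntermediateField K Ω) [CharP E p] {n : ℕ}
    (u : TruncatedWittVector p (n + 1) K)
    (y : TruncatedWittVector p (n + 1) Ω)
    (hy : twFrobenius p (n + 1) y - y = twMap p (n + 1) (algebraMap K Ω) u)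
    (hE : ∀ i : Fin (n + 1), i.val < n → y.coeff i ∈ E) :
    ∃ Y : WittVector p E, (∀ i : Fin (n + 1), i.val < n → (Y.coeff i : Ω) = y.coeff i) ∧
      (∀ i : Fin (n + 1), i.val < n → (frobenius Y - Y).coeff i = algebraMap K E (u.coeff i)) ∧
      ((frobenius (init n Y) - init n Y).coeff n : Ω) =
        algebraMap K Ω (u.coeff (Fin.last n)) + y.coeff (Fin.last n) -
          y.coeff (Fin.last n) ^ p := by
  let Y : WittVector p E := WittVector.mk p fun i =>
    if h : i < n then ⟨y.coeff ⟨i, by omega⟩, hE _ h⟩ else 0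
  have hYc : ∀ i : Fin (n + 1), i.val < n → (Y.coeff i : Ω) = y.coeff i := by
    intro i hi
    simp [Y, hi]
  have hYi : WittVector.map (algebraMap E Ω) Y = init n y.out := by
    ext i
    rw [WittVector.map_coeff, init_coeff]
    split_ifs with hi
    · have h := TruncatedWittVector.coeff_out (p := p) y ⟨i, by omega⟩
      exact (hYc ⟨i, by omega⟩ hi).trans h.symm
    · simp [Y, hi]
  have hYn : init n Y = Y := by
    ext i
    rw [init_coeff]
    split_ifs with hi
    · rfl
    · simp [Y, hi]
  have hmap : WittVector.map (algebraMap E Ω) (frobenius Y - Y) =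
      frobenius (init n y.out) - init n y.out := by
    rw [map_sub, hYi]
    congr 1
    ext i
    rw [WittVector.map_coeff, coeff_frobenius_charP, coeff_frobenius_charP, map_pow, ← hYi,
      WittVector.map_coeff]
  have hc : ∀ i : Fin (n + 1), (frobenius y.out - y.out).coeff i = algebraMap K Ω (u.coeff i) := by
    intro i
    rw [truncate_frobenius_sub, hy]
    simp [twMap]
  refine ⟨Y, hYc, fun i hi => ?_, ?_⟩
  · apply (algebraMap E Ω).injective
    rw [← WittVector.map_coeff, hmap, frobenius_sub_coeff_of_init _ hi, hc]
    rfl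
  · rw [hYn]
    change algebraMap E Ω _ = _
    have h1 := frobenius_sub_coeff y.out n
    have h2 := hc (Fin.last n)
    have h3 := TruncatedWittVector.coeff_out (p := p) y (Fin.last n)
    rw [Fin.val_last] at h2 h3
    rw [h2, h3] at h1
    rw [← WittVector.map_coeff, hmap]
    linear_combination -h1

theorem towerField_eq_top {p : ℕ} {K Ω : Type*} [Field K] [Field Ω] [Algebra K Ω] {S : Set Ω}
    {E : IntermediateField K Ω} (hE : E = IntermediateField.adjoin K S) (Y : WittVector p E) {n : ℕ}
    (hS : ∀ x ∈ S, ∃ i < n, (Y.coeff i : Ω) = x) : towerField K Y n = ⊤ := by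
  apply IntermediateField.lift_injective E
  rw [IntermediateField.lift_top]
  refine le_antisymm (IntermediateField.lift_le _) ?_
  conv_lhs => rw [hE]
  refine IntermediateField.adjoin_le_iff.mpr fun x hx => ?_
  obtain ⟨i, hi, rfl⟩ := hS x hx
  exact (IntermediateField.mem_lift _).mpr (IntermediateField.subset_adjoin _ _ ⟨i, hi, rfl⟩)

/-- The Mathlib valuation attached to a valuation in the sense of `IsAddValuation`. -/
def IsAddValuation.toAddValuation {L : Type*} [Field L] {v : L → WithTop ℤ}
    (hv : IsAddValuation v) : AddValuation L (WithTop ℤ) :=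
  AddValuation.of v ((hv.1 0).mpr rfl) (by
    have h1 := hv.2.1 1 1
    obtain ⟨a, ha⟩ := WithTop.ne_top_iff_exists.mp (mt (hv.1 1).mp one_ne_zero)
    rw [mul_one, ← ha, ← WithTop.coe_add, WithTop.coe_inj] at h1
    rw [← ha, ← WithTop.coe_zero, WithTop.coe_inj]
    omega) hv.2.2 hv.2.1

end CarryReduction

/-- In the Artin–Schreier–Witt tower setting of length `n+1` (with `n ≥ 1`),
let `z = u_n + y_n − y_n^p ∈ L_n`, let `m_n = max_{0≤i≤n−1} p^{n−1−i} ν_i` and let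
`μ_n = deg𝔇_{L_n/K} − p^n + 1`. Then there is `h ∈ L_n` with
`v_{L_n}(z − (h^p − h)) = −(p^{n+1}·m_n − μ_n)`. -/
theorem asw_carry_adjusted_valuation (p : ℕ) [Fact p.Prime] (k : Type*) [Field k] [CharP k p]
    [PerfectField k] (n : ℕ) (hn : 1 ≤ n)
    -- `K` is the field `k((s))` of Laurent series over `k`, with valuation `v_K = order ∘ ι`
    (K : Type*) [Field K] (ι : K ≃+* LaurentSeries k)
    -- the Witt vector `u` of length `n+1` over `K`, with pole orders `ν_i` prime to `p`
    (u : TruncatedWittVector p (n + 1) K)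
    (ν : ℕ → ℕ) (hν : ∀ i ≤ n, 0 < ν i ∧ ¬ p ∣ ν i)
    (hu : ∀ i : Fin (n + 1), u.coeff i ≠ 0)
    (hord : ∀ i : Fin (n + 1), (ι (u.coeff i)).order = -(ν i.val : ℤ))
    -- a separable closure `Ω` of `K` and a solution `y` of `F(y) − y = u` with entries in `Ω`
    (Ω : Type*) [Field Ω] [Algebra K Ω] [IsSepClosed Ω] [Algebra.IsSeparable K Ω]
    (y : TruncatedWittVector p (n + 1) Ω)
    (hy : twFrobenius p (n + 1) y - y = twMap p (n + 1) (algebraMap K Ω) u)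
    -- `L_n = K(y_0, …, y_{n−1})`, cyclic totally ramified of degree `p^n` over `K`
    (Ln : IntermediateField K Ω)
    (hLn : Ln = IntermediateField.adjoin K {x | ∃ i : Fin (n + 1), i.val < n ∧ y.coeff i = x})
    [IsGalois K ↥Ln] [FiniteDimensional K ↥Ln] [IsCyclic (↥Ln ≃ₐ[K] ↥Ln)]
    (hdeg : Module.finrank K ↥Ln = p ^ n)
    -- the normalized valuation `v_{L_n}` of `L_n`
    (v : ↥Ln → WithTop ℤ) (hv : IsAddValuation v)
    (hvK : ∀ x : K, x ≠ 0 →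
      v (algebraMap K ↥Ln x) = ((p ^ n * (ι x).order : ℤ) : WithTop ℤ))
    -- the valuation rings `O_{L_n}` and `O_K` (inside `L_n`), and a uniformizer of `O_{L_n}`
    (OL OK : Subring ↥Ln)
    (hOL : ∀ z, z ∈ OL ↔ 0 ≤ v z)
    (hOK : ∀ z, z ∈ OK ↔ ∃ x : K, 0 ≤ (ι x).order ∧ algebraMap K ↥Ln x = z)
    (hle : OK ≤ OL)
    (t : ↥OL) (ht : v (t : ↥Ln) = 1)
    -- `d = deg𝔇_{L_n/K}`: the different `Ann(Ω¹_{O_{L_n}/O_K})` is the `d`-th power of the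
    -- maximal ideal of `O_{L_n}`, and `μ_n = d − p^n + 1`
    (d : ℕ)
    (hd : letI := (Subring.inclusion hle).toAlgebra;
      Module.annihilator ↥OL (KaehlerDifferential ↥OK ↥OL) = Ideal.span {t} ^ d)
    (μ : ℤ) (hμ : μ = (d : ℤ) - p ^ n + 1)
    -- the element `z = u_n + y_n − y_n^p` lies in `L_n`
    (hz : algebraMap K Ω (u.coeff (Fin.last n)) + y.coeff (Fin.last n)
        - y.coeff (Fin.last n) ^ p ∈ Ln) :
    ∃ h : ↥Ln,
      v ((⟨algebraMap K Ω (u.coeff (Fin.last n)) + y.coeff (Fin.last n)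
            - y.coeff (Fin.last n) ^ p, hz⟩ : ↥Ln) - (h ^ p - h)) =
        ((-((p : ℤ) ^ (n + 1) *
            (((Finset.range n).sup fun i => p ^ (n - 1 - i) * ν i : ℕ) : ℤ) - μ) : ℤ) :
          WithTop ℤ) := by
  subst hμ
  let V := hv.toAddValuation
  have hV : ∀ z, V z = v z := fun z => rfl
  have hk : CharP K p := by
    have : CharP (LaurentSeries k) p := charP_of_injective_ringHom HahnSeries.C_injective p
    exact charP_of_injective_ringHom (f := (ι.symm : LaurentSeries k →+* K)) ι.symm.injective p
  have hΩ : CharP Ω p := charP_of_injective_algebraMap (algebraMap K Ω).injective p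
  have hL : CharP Ln p := charP_of_injective_algebraMap (algebraMap K Ln).injective p
  obtain ⟨Y, hYy, hYu, hYz⟩ := exists_witt_lift Ln u y hy fun i hi => by
    rw [hLn]
    exact IntermediateField.subset_adjoin _ _ ⟨i, hi, rfl⟩
  have htop := towerField_eq_top hLn Y (n := n) fun x ⟨i, hi, hx⟩ => ⟨i, hi, (hYy i hi).trans hx⟩
  have hVK : ∀ x : K, 0 ≤ V (algebraMap K Ln x) ↔ 0 ≤ (ι x).order := by
    intro x
    by_cases hx : x = 0
    · simp [hx]
    · have hpn : (0 : ℤ) < p ^ n := by exact_mod_cast pow_pos (Fact.out : p.Prime).pos n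
      rw [hV, hvK x hx, ← WithTop.coe_zero, WithTop.coe_le_coe, mul_nonneg_iff_of_pos_left hpn]
  obtain ⟨h, hh⟩ := exists_reduced_carry ι (V := V) (Y := Y) hn (fun i hi => hν i hi.le) hvK
    (fun i hi => ⟨u.coeff ⟨i, by omega⟩, hu _, hord _, (hYu ⟨i, by omega⟩ hi).symm⟩) htop hdeg hOL
    (fun z => by
      rw [hOK]
      constructor
      · rintro ⟨x, hx, rfl⟩
        exact ⟨⟨x, rfl⟩, (hVK x).mpr hx⟩
      · rintro ⟨⟨x, rfl⟩, hx⟩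
        exact ⟨x, (hVK x).mp hx, rfl⟩) hle ht hd
  refine ⟨h, ?_⟩
  have hzY : (⟨_, hz⟩ : Ln) =
      (WittVector.frobenius (WittVector.init n Y) - WittVector.init n Y).coeff n :=
    Subtype.ext hYz.symm
  rw [hzY]
  exact hh
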